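/- Let r** denote the radius of convergence of the real power series 𝓑(r) (which has nonnegative coefficients and 𝓑(r) ≥ 1). Then for every n ≥ 1 and every r with 0 < r < r**, the virial coefficients satisfy |β_{n+1}|/(n+1)! ≤ (1/(n+1)) · (2/r − 1/(r·𝓑(r)))^n; consequently |β_{n+1}|/(n+1)! ≤ (1/(n+1)) · (inf_{0<r<r**} (2/r − 1/(r·𝓑(r))))^n, and the radius of convergence of the virial series ρ ↦ Σ_{n≥1} (β_n/n!) ρ^n is at least sup_{0<r<r**} r·𝓑(r)/(2·𝓑(r) − 1). -/

import Mathlib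

open MeasureTheory ENNReal
open scoped Classical

noncomputable section

/-- Pair weight `w(x,y) = exp(-β φ(x-y))`, with `exp(-(+∞)) = 0`. -/
def pairW {d : ℕ} (β : ℝ) (φ : (Fin d → ℝ) → ℝ≥0∞) (x y : Fin d → ℝ) : ℝ :=
  if φ (x - y) = ∞ then 0 else Real.exp (-(β * (φ (x - y)).toReal))

/-- Truncated weight `ω^T_n`: sum over connected graphs on `{1,…,n}`. -/
def omegaT {S : Type*} (w : S → S → ℝ) (n : ℕ) (x : Fin n → S) : ℝ :=
  ∑ G : SimpleGraph (Fin n),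
    if G.Connected then
      ∏ p ∈ Finset.univ.filter (fun p : Fin n × Fin n => p.1 < p.2 ∧ G.Adj p.1 p.2),
        (w (x p.1) (x p.2) - 1)
    else 0

/-- `φ_n(x; x_1,…,x_n) = Π_i (1 - w(x,x_i)) Π_{i<j} w(x_i,x_j)`. -/
def phiVertex {S : Type*} (w : S → S → ℝ) (n : ℕ) (x : S) (y : Fin n → S) : ℝ :=
  (∏ i, (1 - w x (y i))) *
    ∏ p ∈ Finset.univ.filter (fun p : Fin n × Fin n => p.1 < p.2), w (y p.1) (y p.2)

/-- `g(n) = ∫_{ℝ^{dn}} φ_n(0; x_1,…,x_n) dx`. -/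
def gCoef {d : ℕ} (β : ℝ) (φ : (Fin d → ℝ) → ℝ≥0∞) (n : ℕ) : ℝ≥0∞ :=
  ∫⁻ y : Fin n → Fin d → ℝ, ENNReal.ofReal (phiVertex (pairW β φ) n 0 y)

/-- The vertex sum `Ψ(t) = 1 + Σ_{n≥1} g(n) t^n/n!` (extended to `t ∈ [0,∞]`). -/
def vertexSum {d : ℕ} (β : ℝ) (φ : (Fin d → ℝ) → ℝ≥0∞) (t : ℝ≥0∞) : ℝ≥0∞ :=
  1 + ∑' n : ℕ, gCoef β φ (n + 1) * t ^ (n + 1) / ((n + 1).factorial : ℝ≥0∞)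

/-- The children of vertex `i` in a tree on `{0,…,n}` rooted at `0`. -/
def childrenF {n : ℕ} (τ : SimpleGraph (Fin (n + 1))) (i : Fin (n + 1)) :
    Finset (Fin (n + 1)) :=
  Finset.univ.filter (fun j => τ.Adj i j ∧ τ.dist 0 j = τ.dist 0 i + 1)

/-- `φ_{|t|}(x; (y_j)_{j∈t})`, the vertex weight of `x` with the family of children `t`. -/
def phiFinset {S : Type*} {n : ℕ} (w : S → S → ℝ) (x : S)
    (t : Finset (Fin n)) (y : Fin n → S) : ℝ :=
  (∏ j ∈ t, (1 - w x (y j))) *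
    ∏ p ∈ (t ×ˢ t).filter (fun p => p.1 < p.2), w (y p.1) (y p.2)

/-- `B_n(x_0; x_1,…,x_n)`: sum over trees rooted at `0` of the product of vertex weights. -/
def treeB {S : Type*} (w : S → S → ℝ) (n : ℕ) (x : Fin (n + 1) → S) : ℝ :=
  ∑ τ : SimpleGraph (Fin (n + 1)),
    if τ.IsTree then ∏ i : Fin (n + 1), phiFinset w (x i) (childrenF τ i) x else 0

/-- The tree sum `𝓑(r) = 1 + Σ_{n≥1} (r^n/n!) ∫ B_n(0;x_1,…,x_n) dx`. -/
def treeSum {d : ℕ} (β : ℝ) (φ : (Fin d → ℝ) → ℝ≥0∞) (r : ℝ) : ℝ≥0∞ :=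
  1 + ∑' n : ℕ, ENNReal.ofReal (r ^ (n + 1) / (n + 1).factorial) *
    ∫⁻ y : Fin (n + 1) → Fin d → ℝ,
      ENNReal.ofReal (treeB (pairW β φ) (n + 1) (Fin.cons 0 y))

/-- `bCoef n` represents the infinite-volume cluster coefficient `b_{n+1}`. -/
def bCoef {d : ℕ} (β : ℝ) (φ : (Fin d → ℝ) → ℝ≥0∞) (n : ℕ) : ℝ :=
  ∫ y : Fin n → Fin d → ℝ, omegaT (pairW β φ) (n + 1) (Fin.cons 0 y)

/-- Generalized binomial coefficient `binom(x,k) = x(x-1)⋯(x-k+1)/k!`. -/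
def genBinom (x : ℝ) (k : ℕ) : ℝ :=
  (∏ i ∈ Finset.range k, (x - i)) / k.factorial

/-- Partial exponential Bell polynomial `B_{n,k}(y_1,…,y_{n-k+1})`. -/
def BellPoly (n k : ℕ) (y : ℕ → ℝ) : ℝ :=
  ∑ α ∈ (Fintype.piFinset fun _ : Fin (n - k + 1) => Finset.range (n + 1)) |>.filter
      (fun α : Fin (n - k + 1) → ℕ =>
        (∑ i, α i) = k ∧ (∑ i : Fin (n - k + 1), (i.1 + 1) * α i) = n),
    (n.factorial : ℝ) / (∏ i, ((α i).factorial : ℝ)) *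
      ∏ i : Fin (n - k + 1), (y (i.1 + 1) / ((i.1 + 1).factorial : ℝ)) ^ (α i)

/-- `vCoef n` represents the virial coefficient `β_{n+1}` (so `vCoef 0 = β_1 = 1`). -/
def vCoef {d : ℕ} (β : ℝ) (φ : (Fin d → ℝ) → ℝ≥0∞) (n : ℕ) : ℝ :=
  if n = 0 then 1 else
    ∑ k ∈ Finset.Icc 1 n,
      genBinom (-(n : ℝ)) k * (k.factorial : ℝ) * BellPoly n k (fun j => bCoef β φ j)

namespace TreeBound

section SetFunctions

variable {ι : Type*} [LinearOrder ι]

/-- The ordered pairs `i < j` of elements of `V`. -/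
def orderedPairs (V : Finset ι) : Finset (ι × ι) := (V ×ˢ V).filter (fun p => p.1 < p.2)

/-- The Boltzmann weight `∏_{i<j} a i j` of the configuration `V`. -/
def boltz (a : ι → ι → ℝ) (V : Finset ι) : ℝ := ∏ p ∈ orderedPairs V, a p.1 p.2

/-- The convolution of two set functions. -/
def conv (f g : Finset ι → ℝ) (T : Finset ι) : ℝ := ∑ S ∈ T.powerset, f S * g (T \ S)

lemma sum_powerset_powerset (F : Finset ι → Finset ι → Finset ι → ℝ) (T : Finset ι) :
    ∑ S ∈ T.powerset, ∑ R ∈ S.powerset, F R (S \ R) (T \ S) =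
      ∑ R ∈ T.powerset, ∑ Q ∈ (T \ R).powerset, F R Q ((T \ R) \ Q) := by
  rw [Finset.sum_sigma', Finset.sum_sigma']
  refine Finset.sum_nbij' (fun x => ⟨x.2, x.1 \ x.2⟩) (fun x => ⟨x.1 ∪ x.2, x.1⟩) ?_ ?_ ?_ ?_ ?_
  · rintro ⟨S, R⟩ h
    simp only [Finset.mem_sigma, Finset.mem_powerset] at h ⊢
    exact ⟨h.2.trans h.1, Finset.sdiff_subset_sdiff h.1 le_rfl⟩
  · rintro ⟨R, Q⟩ h
    simp only [Finset.mem_sigma, Finset.mem_powerset] at h ⊢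
    exact ⟨Finset.union_subset h.1 (h.2.trans Finset.sdiff_subset), Finset.subset_union_left⟩
  · rintro ⟨S, R⟩ h
    simp only [Finset.mem_sigma, Finset.mem_powerset] at h
    simp [Finset.union_sdiff_of_subset h.2]
  · rintro ⟨R, Q⟩ h
    simp only [Finset.mem_sigma, Finset.mem_powerset] at h
    have hd : Disjoint R Q := Finset.disjoint_of_subset_right h.2 Finset.disjoint_sdiff
    simp [Finset.union_sdiff_cancel_left hd]
  · rintro ⟨S, R⟩ h
    simp only [Finset.mem_sigma, Finset.mem_powerset] at h
    congr 1
    ext i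
    have := @h.2 i
    simp only [Finset.mem_sdiff]
    tauto

lemma sum_powerset_sum_mem (F : ι → Finset ι → Finset ι → ℝ) (T : Finset ι) :
    ∑ S ∈ T.powerset, ∑ m ∈ S, F m (S.erase m) (T \ S) =
      ∑ m ∈ T, ∑ Q ∈ (T.erase m).powerset, F m Q ((T.erase m) \ Q) := by
  rw [Finset.sum_sigma', Finset.sum_sigma']
  refine Finset.sum_nbij' (fun x => ⟨x.2, x.1.erase x.2⟩) (fun x => ⟨insert x.1 x.2, x.1⟩)
    ?_ ?_ ?_ ?_ ?_
  · rintro ⟨S, m⟩ h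
    simp only [Finset.mem_sigma, Finset.mem_powerset] at h ⊢
    exact ⟨h.1 h.2, Finset.erase_subset_erase m h.1⟩
  · rintro ⟨m, Q⟩ h
    simp only [Finset.mem_sigma, Finset.mem_powerset] at h ⊢
    exact ⟨Finset.insert_subset h.1 (h.2.trans (Finset.erase_subset _ _)),
      Finset.mem_insert_self _ _⟩
  · rintro ⟨S, m⟩ h
    simp only [Finset.mem_sigma, Finset.mem_powerset] at h
    simp [Finset.insert_erase h.2]
  · rintro ⟨m, Q⟩ h
    simp only [Finset.mem_sigma, Finset.mem_powerset] at h
    have : m ∉ Q := fun hm => by simpa using h.2 hm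
    simp [Finset.erase_insert this]
  · rintro ⟨S, m⟩ h
    simp only [Finset.mem_sigma, Finset.mem_powerset] at h
    congr 1
    ext i
    simp only [Finset.mem_sdiff, Finset.mem_erase]
    have := h.2
    by_cases hi : i = m
    · subst hi; simp [this]
    · simp [hi]

lemma conv_assoc (f g h : Finset ι → ℝ) : conv (conv f g) h = conv f (conv g h) := by
  ext T
  simp only [conv, Finset.sum_mul, Finset.mul_sum]
  rw [sum_powerset_powerset (fun R Q P => f R * g Q * h P)]
  exact Finset.sum_congr rfl fun R _ => Finset.sum_congr rfl fun Q _ => by ring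

lemma eq_of_conv_eq_on {f f' g : Finset ι → ℝ} (hg : g ∅ = 1) {T : Finset ι}
    (h : ∀ S ⊆ T, conv f g S = conv f' g S) : f T = f' T := by
  induction T using Finset.strongInduction with
  | H T ih =>
    have hT := h T le_rfl
    have hmem : T ∈ T.powerset := by simp
    simp only [conv] at hT
    rw [← Finset.add_sum_erase _ _ hmem, ← Finset.add_sum_erase _ _ hmem] at hT
    simp only [sdiff_self, Finset.bot_eq_empty, hg, mul_one] at hT
    have : ∑ S ∈ T.powerset.erase T, f S * g (T \ S) =
        ∑ S ∈ T.powerset.erase T, f' S * g (T \ S) := by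
      refine Finset.sum_congr rfl fun S hS => ?_
      simp only [Finset.mem_erase, Finset.mem_powerset] at hS
      rw [ih S (Finset.ssubset_iff_subset_ne.2 ⟨hS.2, hS.1⟩)
        fun R hR => h R (hR.trans hS.2)]
    linarith

lemma eq_of_conv_eq {f f' g : Finset ι → ℝ} (hg : g ∅ = 1) (h : conv f g = conv f' g) :
    f = f' :=
  funext fun _ => eq_of_conv_eq_on hg fun _ _ => by rw [h]

@[simp] lemma boltz_empty (a : ι → ι → ℝ) : boltz a ∅ = 1 := by simp [boltz, orderedPairs]

lemma boltz_insert {a : ι → ι → ℝ} (ha : ∀ i j, a i j = a j i) {i : ι} {V : Finset ι}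
    (hi : i ∉ V) : boltz a (insert i V) = (∏ j ∈ V, a i j) * boltz a V := by
  have h : orderedPairs (insert i V) = orderedPairs V ∪
      V.image (fun j => if i < j then (i, j) else (j, i)) := by
    ext ⟨p, q⟩
    simp only [orderedPairs, Finset.mem_filter, Finset.mem_product, Finset.mem_insert,
      Finset.mem_union, Finset.mem_image]
    constructor
    · rintro ⟨⟨rfl | hp, rfl | hq⟩, hpq⟩
      · exact absurd hpq (lt_irrefl _)
      · exact Or.inr ⟨q, hq, by simp [hpq]⟩
      · exact Or.inr ⟨p, hp, by simp [hpq.not_gt]⟩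
      · exact Or.inl ⟨⟨hp, hq⟩, hpq⟩
    · rintro (⟨⟨hp, hq⟩, hpq⟩ | ⟨j, hj, hjq⟩)
      · exact ⟨⟨Or.inr hp, Or.inr hq⟩, hpq⟩
      · have hne : i ≠ j := fun e => hi (e ▸ hj)
        split_ifs at hjq with hij
        · cases hjq; exact ⟨⟨Or.inl rfl, Or.inr hj⟩, hij⟩
        · cases hjq
          exact ⟨⟨Or.inr hj, Or.inl rfl⟩, lt_of_le_of_ne (not_lt.1 hij) hne.symm⟩
  rw [boltz, h, Finset.prod_union, Finset.prod_image, mul_comm]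
  · congr 1
    refine Finset.prod_congr rfl fun j _ => ?_
    split_ifs
    · rfl
    · exact ha _ _
  · intro j hj k hk hjk
    dsimp only at hjk
    split_ifs at hjk <;> simp_all
  · rw [Finset.disjoint_left]
    rintro ⟨p, q⟩ hpq h'
    simp only [orderedPairs, Finset.mem_filter, Finset.mem_product, Finset.mem_image] at hpq h'
    obtain ⟨j, hj, hjq⟩ := h'
    split_ifs at hjq <;> cases hjq <;> tauto

lemma boltz_union {a : ι → ι → ℝ} (ha : ∀ i j, a i j = a j i) {S V : Finset ι}
    (h : Disjoint S V) :
    boltz a (S ∪ V) = boltz a S * ((∏ j ∈ V, ∏ i ∈ S, a i j) * boltz a V) := by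
  induction S using Finset.induction_on with
  | empty => simp
  | insert i S hi ih =>
    rw [Finset.disjoint_insert_left] at h
    rw [Finset.insert_union, boltz_insert ha (by simp [hi, h.1]), ih h.2, boltz_insert ha hi,
      Finset.prod_union h.2]
    simp only [Finset.prod_insert hi, Finset.prod_mul_distrib]
    ring

lemma boltz_nonneg {a : ι → ι → ℝ} (h0 : ∀ i j, 0 ≤ a i j) (V : Finset ι) : 0 ≤ boltz a V :=
  Finset.prod_nonneg fun _ _ => h0 _ _

/-- The unsigned set function `N` with `(-1)^{|T|} N(T)` the convolution quotient of the
Boltzmann weights with one-point activities `r v` and `v`. -/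
def ratio (a : ι → ι → ℝ) (v : ι → ℝ) (r : ι → ℝ) (T : Finset ι) : ℝ :=
  if T = ∅ then 1 else
    ∑ S ∈ (T.powerset.erase ∅).attach, (∏ s ∈ S.1, (1 - r s) * v s) * boltz a S.1 *
      ratio a v (fun t => ∏ s ∈ S.1, a s t) (T \ S.1)
termination_by T.card
decreasing_by
  have := S.2
  simp only [Finset.mem_erase, Finset.mem_powerset] at this
  exact Finset.card_lt_card (Finset.sdiff_ssubset this.2 (Finset.nonempty_iff_ne_empty.2 this.1))

@[simp] lemma ratio_empty (a : ι → ι → ℝ) (v r : ι → ℝ) : ratio a v r ∅ = 1 := by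
  rw [ratio]; simp

lemma ratio_of_ne_empty (a : ι → ι → ℝ) (v r : ι → ℝ) {T : Finset ι} (hT : T ≠ ∅) :
    ratio a v r T = ∑ S ∈ T.powerset.erase ∅, (∏ s ∈ S, (1 - r s) * v s) * boltz a S *
      ratio a v (fun t => ∏ s ∈ S, a s t) (T \ S) := by
  rw [ratio, if_neg hT, Finset.sum_attach (T.powerset.erase ∅) (fun S =>
    (∏ s ∈ S, (1 - r s) * v s) * boltz a S * ratio a v (fun t => ∏ s ∈ S, a s t) (T \ S))]

lemma ratio_one (a : ι → ι → ℝ) (v : ι → ℝ) (T : Finset ι) :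
    ratio a v (fun _ => 1) T = if T = ∅ then 1 else 0 := by
  split_ifs with h
  · simp [h]
  · rw [ratio_of_ne_empty _ _ _ h]
    refine Finset.sum_eq_zero fun S hS => ?_
    simp only [Finset.mem_erase] at hS
    obtain ⟨s, hs⟩ := Finset.nonempty_iff_ne_empty.2 hS.1
    rw [Finset.prod_eq_zero hs (by simp)]
    simp

lemma ratio_eq_sum (a : ι → ι → ℝ) (v r : ι → ℝ) (T : Finset ι) :
    ratio a v r T = ∑ S ∈ T.powerset, (∏ s ∈ S, (1 - r s) * v s) * boltz a S *
      ratio a v (fun t => ∏ s ∈ S, a s t) (T \ S) := by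
  rw [← Finset.add_sum_erase _ _ (Finset.empty_mem_powerset T)]
  by_cases h : T = ∅
  · subst h; simp
  · rw [ratio_of_ne_empty _ _ _ h]
    simp [ratio_one, h]

/-- The signed version of `ratio`. -/
def sratio (a : ι → ι → ℝ) (v r : ι → ℝ) (T : Finset ι) : ℝ := (-1) ^ T.card * ratio a v r T

@[simp] lemma sratio_empty (a : ι → ι → ℝ) (v r : ι → ℝ) : sratio a v r ∅ = 1 := by
  simp [sratio]

lemma sratio_eq_sum (a : ι → ι → ℝ) (v r : ι → ℝ) (T : Finset ι) :
    sratio a v r T = ∑ S ∈ T.powerset, ((∏ s ∈ S, (-(1 - r s) * v s)) * boltz a S) *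
      sratio a v (fun t => ∏ s ∈ S, a s t) (T \ S) := by
  rw [sratio, ratio_eq_sum, Finset.mul_sum]
  refine Finset.sum_congr rfl fun S hS => ?_
  rw [Finset.mem_powerset] at hS
  have h1 : (-1 : ℝ) ^ T.card = (-1) ^ S.card * (-1) ^ (T \ S).card := by
    rw [← pow_add, add_comm, Finset.card_sdiff_add_card_eq_card hS]
  have h2 : ∏ s ∈ S, (-(1 - r s) * v s) = (-1) ^ S.card * ∏ s ∈ S, (1 - r s) * v s := by
    rw [← Finset.prod_const, ← Finset.prod_mul_distrib]
    exact Finset.prod_congr rfl fun _ _ => by ring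
  rw [h1, h2, sratio]
  ring

/-- The Boltzmann weight with one-point activity `v`. -/
def actBoltz (a : ι → ι → ℝ) (v : ι → ℝ) (T : Finset ι) : ℝ := (∏ t ∈ T, v t) * boltz a T

@[simp] lemma actBoltz_empty (a : ι → ι → ℝ) (v : ι → ℝ) : actBoltz a v ∅ = 1 := by
  simp [actBoltz]

lemma conv_sratio {a : ι → ι → ℝ} (ha : ∀ i j, a i j = a j i) (v r : ι → ℝ) :
    conv (sratio a v r) (actBoltz a v) = actBoltz a (fun t => r t * v t) := by
  ext T
  induction hn : T.card using Nat.strong_induction_on generalizing T r with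
  | _ n ih =>
    subst hn
    have h1 : conv (sratio a v r) (actBoltz a v) T = ∑ S ∈ T.powerset,
        ((∏ s ∈ S, (-(1 - r s) * v s)) * boltz a S) *
          conv (sratio a v (fun t => ∏ s ∈ S, a s t)) (actBoltz a v) (T \ S) := by
      simp only [conv, Finset.mul_sum]
      conv_lhs =>
        enter [2, S]
        rw [sratio_eq_sum, Finset.sum_mul]
      rw [sum_powerset_powerset (fun R Q P => ((∏ s ∈ R, (-(1 - r s) * v s)) * boltz a R) *
        sratio a v (fun t => ∏ s ∈ R, a s t) Q * actBoltz a v P)]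
      exact Finset.sum_congr rfl fun R _ => Finset.sum_congr rfl fun Q _ => by ring
    have h2 : ∀ S ∈ T.powerset,
        conv (sratio a v (fun t => ∏ s ∈ S, a s t)) (actBoltz a v) (T \ S) =
          actBoltz a (fun t => (∏ s ∈ S, a s t) * v t) (T \ S) := by
      intro S hS
      rw [Finset.mem_powerset] at hS
      by_cases hS0 : S = ∅
      · subst hS0
        simp only [Finset.prod_empty, one_mul, Finset.sdiff_empty, conv]
        rw [Finset.sum_eq_single_of_mem ∅ (by simp)]
        · simp
        · intro b _ hb
          simp [sratio, ratio_one, hb]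
      · exact ih _ (Finset.card_lt_card (Finset.sdiff_ssubset hS
          (Finset.nonempty_iff_ne_empty.2 hS0))) _ _ rfl
    rw [h1, Finset.sum_congr rfl fun S hS => by rw [h2 S hS]]
    have h3 : actBoltz a (fun t => r t * v t) T =
        (∏ t ∈ T, (-(1 - r t) * v t + v t)) * boltz a T := by
      rw [actBoltz]
      congr 1
      exact Finset.prod_congr rfl fun _ _ => by ring
    rw [h3, Finset.prod_add, Finset.sum_mul]
    refine Finset.sum_congr rfl fun S hS => ?_
    rw [Finset.mem_powerset] at hS
    have h4 := boltz_union ha (Finset.disjoint_sdiff (s := S) (t := T))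
    rw [Finset.union_sdiff_of_subset hS] at h4
    rw [h4]
    simp only [actBoltz, Finset.prod_mul_distrib]
    ring

/-- Chain rule for quotients. -/
lemma sratio_mul {a : ι → ι → ℝ} (ha : ∀ i j, a i j = a j i) (v r s : ι → ℝ) :
    sratio a v (fun t => r t * s t) =
      conv (sratio a (fun t => s t * v t) r) (sratio a v s) := by
  apply eq_of_conv_eq (actBoltz_empty a v)
  rw [conv_assoc, conv_sratio ha, conv_sratio ha, conv_sratio ha]
  simp only [mul_assoc]

/-- Expansion of a quotient along the first factor of an ordered product. -/
lemma sratio_ordered {a : ι → ι → ℝ} (ha : ∀ i j, a i j = a j i) (r : ι → ℝ) (T : Finset ι) :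
    sratio a (fun _ => 1) r T = (if T = ∅ then 1 else 0) - ∑ m ∈ T, (1 - r m) *
      sratio a (fun _ => 1) (fun t => (if t < m then r t else 1) * a m t) (T.erase m) := by
  revert T
  rw [← funext_iff (g := fun T => (if T = ∅ then 1 else 0) - ∑ m ∈ T, (1 - r m) *
      sratio a (fun _ => 1) (fun t => (if t < m then r t else 1) * a m t) (T.erase m))]
  apply eq_of_conv_eq (actBoltz_empty a (fun _ => 1))
  rw [conv_sratio ha]
  ext T
  simp only [conv, sub_mul _ _ (actBoltz _ _ _), Finset.sum_sub_distrib, Finset.sum_mul]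
  rw [Finset.sum_eq_single_of_mem ∅ (by simp) (by intro b _ hb; simp [hb]),
    sum_powerset_sum_mem (fun m Q P => (1 - r m) * sratio a (fun _ => 1)
      (fun t => (if t < m then r t else 1) * a m t) Q * actBoltz a (fun _ => 1) P)]
  have h1 : ∀ m ∈ T, ∑ Q ∈ (T.erase m).powerset, (1 - r m) * sratio a (fun _ => 1)
      (fun t => (if t < m then r t else 1) * a m t) Q *
        actBoltz a (fun _ => 1) (T.erase m \ Q) =
      ((1 - r m) * ∏ t ∈ T with t < m, r t) * boltz a T := by
    intro m hm
    have := congrFun (conv_sratio ha (fun _ => 1)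
      (fun t => (if t < m then r t else 1) * a m t)) (T.erase m)
    simp only [conv] at this
    simp only [mul_assoc]
    rw [← Finset.mul_sum, this, actBoltz]
    have h2 := boltz_insert ha (Finset.notMem_erase m T)
    rw [Finset.insert_erase hm] at h2
    rw [h2, Finset.prod_filter, ← Finset.mul_prod_erase T _ hm]
    simp only [lt_irrefl, if_false, one_mul, mul_one, Finset.prod_mul_distrib]
    ring
  rw [Finset.sum_congr rfl h1, ← Finset.sum_mul]
  have h2 := Finset.prod_one_sub_ordered T (fun t => 1 - r t)
  simp only [_root_.sub_sub_cancel] at h2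
  simp only [if_true, actBoltz, mul_one, h2, Finset.sdiff_empty, Finset.prod_const_one, one_mul]
  ring

lemma ratio_nonneg {a : ι → ι → ℝ} (h0 : ∀ i j, 0 ≤ a i j) (h1 : ∀ i j, a i j ≤ 1)
    {v r : ι → ℝ} (hv : ∀ i, 0 ≤ v i) (hr : ∀ i, r i ≤ 1) (T : Finset ι) :
    0 ≤ ratio a v r T := by
  induction hn : T.card using Nat.strong_induction_on generalizing T r with
  | _ n ih =>
    subst hn
    by_cases hT : T = ∅
    · simp [hT]
    rw [ratio_of_ne_empty _ _ _ hT]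
    refine Finset.sum_nonneg fun S hS => ?_
    simp only [Finset.mem_erase, Finset.mem_powerset] at hS
    refine mul_nonneg (mul_nonneg (Finset.prod_nonneg fun s _ =>
      mul_nonneg (sub_nonneg.2 (hr s)) (hv s)) (boltz_nonneg h0 S)) ?_
    exact ih _ (Finset.card_lt_card (Finset.sdiff_ssubset hS.2
      (Finset.nonempty_iff_ne_empty.2 hS.1)))
      (fun i => Finset.prod_le_one (fun _ _ => h0 _ _) fun _ _ => h1 _ _) _ rfl

lemma boltz_map {κ : Type*} [LinearOrder κ] (e : κ ↪o ι) (a : ι → ι → ℝ) (V : Finset κ) :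
    boltz a (V.map e.toEmbedding) = boltz (fun i j => a (e i) (e j)) V := by
  have : orderedPairs (V.map e.toEmbedding) =
      (orderedPairs V).map (e.toEmbedding.prodMap e.toEmbedding) := by
    ext ⟨p, q⟩
    simp only [orderedPairs, Finset.mem_filter, Finset.mem_product, Finset.mem_map,
      RelEmbedding.coe_toEmbedding, Prod.exists, Function.Embedding.prodMap, Prod.mk.injEq,
      Function.Embedding.coeFn_mk, Prod.map_apply]
    constructor
    · rintro ⟨⟨⟨i, hi, rfl⟩, ⟨j, hj, rfl⟩⟩, h⟩
      exact ⟨i, j, ⟨⟨hi, hj⟩, e.lt_iff_lt.1 h⟩, rfl, rfl⟩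
    · rintro ⟨i, j, ⟨⟨hi, hj⟩, h⟩, rfl, rfl⟩
      exact ⟨⟨⟨i, hi, rfl⟩, ⟨j, hj, rfl⟩⟩, e.lt_iff_lt.2 h⟩
  simp [boltz, this, Function.Embedding.prodMap]

lemma ratio_map {κ : Type*} [LinearOrder κ] (e : κ ↪o ι) (a : ι → ι → ℝ) (v r : ι → ℝ)
    (T : Finset κ) : ratio a v r (T.map e.toEmbedding) =
      ratio (fun i j => a (e i) (e j)) (fun i => v (e i)) (fun i => r (e i)) T := by
  induction hn : T.card using Nat.strong_induction_on generalizing T r with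
  | _ n ih =>
    subst hn
    by_cases hT : T = ∅
    · simp [hT]
    rw [ratio_of_ne_empty _ _ _ hT, ratio_of_ne_empty _ _ _ (by simpa using hT)]
    symm
    refine Finset.sum_nbij (fun S => S.map e.toEmbedding) ?_ ?_ ?_ ?_
    · intro S hS
      simp only [Finset.mem_erase, Finset.mem_powerset] at hS ⊢
      exact ⟨by simpa using hS.1, Finset.map_subset_map.2 hS.2⟩
    · exact (Finset.map_injective _).injOn
    · intro S hS
      simp only [Finset.coe_erase, Set.mem_sdiff, Finset.mem_coe, Finset.mem_powerset,
        Set.mem_singleton_iff] at hS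
      obtain ⟨S', hS', rfl⟩ := Finset.subset_map_iff.1 hS.1
      exact ⟨S', by simpa using ⟨hS', by simpa using hS.2⟩, rfl⟩
    · intro S hS
      simp only [Finset.mem_erase, Finset.mem_powerset] at hS
      rw [boltz_map, ← Finset.map_sdiff, ih _ (Finset.card_lt_card (Finset.sdiff_ssubset hS.2
        (Finset.nonempty_iff_ne_empty.2 hS.1))) _ _ rfl]
      simp

lemma measurable_ratio {Ω : Type*} [MeasurableSpace Ω] {a : Ω → ι → ι → ℝ} {v r : Ω → ι → ℝ}
    (ha : ∀ i j, Measurable fun ω => a ω i j) (hv : ∀ i, Measurable fun ω => v ω i)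
    (hr : ∀ i, Measurable fun ω => r ω i) (T : Finset ι) :
    Measurable fun ω => ratio (a ω) (v ω) (r ω) T := by
  induction hn : T.card using Nat.strong_induction_on generalizing T r with
  | _ n ih =>
    subst hn
    by_cases hT : T = ∅
    · simp [hT]
    simp only [ratio_of_ne_empty _ _ _ hT]
    refine Finset.measurable_fun_sum _ fun S hS => ?_
    simp only [Finset.mem_erase, Finset.mem_powerset] at hS
    refine Measurable.mul (Measurable.mul (Finset.measurable_fun_prod _ fun s _ =>
      (measurable_const.sub (hr s)).mul (hv s)) (Finset.measurable_fun_prod _ fun p _ => ha _ _)) ?_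
    exact ih _ (Finset.card_lt_card (Finset.sdiff_ssubset hS.2
        (Finset.nonempty_iff_ne_empty.2 hS.1)))
        (fun i => Finset.measurable_fun_prod _ fun p _ => ha _ _) _ rfl

end SetFunctions

section ConnectedGraphs

variable {ι : Type*}

/-- `u` and `v` are joined by a pair of `E`. -/
def Joined (E : Finset (ι × ι)) (u v : ι) : Prop := (u, v) ∈ E ∨ (v, u) ∈ E

/-- `v` is connected to `o` by pairs of `E`. -/
def Reach (E : Finset (ι × ι)) (o v : ι) : Prop := Relation.ReflTransGen (Joined E) o v

lemma Reach.mono {E F : Finset (ι × ι)} (h : E ⊆ F) {o v : ι} (hr : Reach E o v) :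
    Reach F o v :=
  Relation.ReflTransGen.mono (fun _ _ => Or.imp (@h _) (@h _)) _ _ hr

variable [LinearOrder ι]

/-- The sum over connected graphs on the vertex set `V` containing `o`. -/
def connSum (a : ι → ι → ℝ) (o : ι) (V : Finset ι) : ℝ :=
  ∑ E ∈ (orderedPairs V).powerset with ∀ v ∈ V, Reach E o v, ∏ p ∈ E, (a p.1 p.2 - 1)

lemma mem_orderedPairs {V : Finset ι} {p : ι × ι} :
    p ∈ orderedPairs V ↔ p.1 ∈ V ∧ p.2 ∈ V ∧ p.1 < p.2 := by
  simp [orderedPairs, and_assoc]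

lemma Joined.mem {E : Finset (ι × ι)} {V : Finset ι} (hE : E ⊆ orderedPairs V) {u v : ι}
    (h : Joined E u v) : u ∈ V ∧ v ∈ V := by
  rcases h with h | h
  · have := mem_orderedPairs.1 (hE h); exact ⟨this.1, this.2.1⟩
  · have := mem_orderedPairs.1 (hE h); exact ⟨this.2.1, this.1⟩

lemma Reach.mem_of_union {E F : Finset (ι × ι)} {o : ι} {T U : Finset ι}
    (hE : E ⊆ orderedPairs (insert o T)) (hF : F ⊆ orderedPairs U)
    (hd : Disjoint (insert o T) U) {v : ι} (hr : Reach (E ∪ F) o v) : v ∈ insert o T := by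
  induction hr with
  | refl => exact Finset.mem_insert_self _ _
  | @tail b c _ hbc ih =>
    have : Joined E b c ∨ Joined F b c := by
      simp only [Joined, Finset.mem_union] at hbc ⊢
      tauto
    rcases this with h | h
    · exact (h.mem hE).2
    · exact absurd (h.mem hF).1 (Finset.disjoint_left.1 hd ih)

lemma sum_connSum_mul_boltz (a : ι → ι → ℝ) {o : ι} {S : Finset ι} (ho : o ∉ S) :
    ∑ T ∈ S.powerset, connSum a o (insert o T) * boltz a (S \ T) = boltz a (insert o S) := by
  have hb : ∀ V : Finset ι,
      boltz a V = ∑ E ∈ (orderedPairs V).powerset, ∏ p ∈ E, (a p.1 p.2 - 1) := by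
    intro V
    rw [← Finset.prod_one_add]
    simp [boltz]
  have hdis : ∀ T : Finset ι, Disjoint (insert o T) (S \ T) := by
    intro T
    rw [Finset.disjoint_insert_left]
    exact ⟨fun h => ho (Finset.mem_sdiff.1 h).1, Finset.disjoint_sdiff⟩
  have hdisP : ∀ T : Finset ι, Disjoint (orderedPairs (insert o T)) (orderedPairs (S \ T)) := by
    intro T
    rw [Finset.disjoint_left]
    intro p hp hq
    exact Finset.disjoint_left.1 (hdis T) (mem_orderedPairs.1 hp).1 (mem_orderedPairs.1 hq).1
  simp only [hb, connSum, Finset.sum_mul_sum, ← Finset.sum_product']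
  rw [Finset.sum_sigma']
  symm
  refine Finset.sum_nbij'
    (fun E => ⟨S.filter (Reach E o), (E ∩ orderedPairs (insert o (S.filter (Reach E o))),
      E ∩ orderedPairs (S \ S.filter (Reach E o)))⟩)
    (fun x => x.2.1 ∪ x.2.2) ?_ ?_ ?_ ?_ ?_
  · intro E hE
    rw [Finset.mem_powerset] at hE
    simp only [Finset.mem_sigma, Finset.mem_powerset, Finset.mem_product, Finset.mem_filter]
    refine ⟨Finset.filter_subset _ _, ⟨Finset.inter_subset_right, fun v hv => ?_⟩,
      Finset.inter_subset_right⟩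
    have hvE : Reach E o v := by
      rcases Finset.mem_insert.1 hv with rfl | hv
      · exact Relation.ReflTransGen.refl
      · exact (Finset.mem_filter.1 hv).2
    clear hv
    induction hvE with
    | refl => exact Relation.ReflTransGen.refl
    | @tail b c hb hbc ih =>
      refine Relation.ReflTransGen.tail ih ?_
      have hc : Reach E o c := Relation.ReflTransGen.tail hb hbc
      have key : ∀ z ∈ insert o S, Reach E o z → z ∈ insert o (S.filter (Reach E o)) := by
        intro z hz hr
        rcases Finset.mem_insert.1 hz with rfl | hz
        · exact Finset.mem_insert_self _ _
        · exact Finset.mem_insert_of_mem (Finset.mem_filter.2 ⟨hz, hr⟩)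
      have hb' := key b (hbc.mem hE).1 hb
      have hc' := key c (hbc.mem hE).2 hc
      rcases hbc with h | h
      · exact Or.inl (Finset.mem_inter.2 ⟨h, mem_orderedPairs.2
          ⟨hb', hc', (mem_orderedPairs.1 (hE h)).2.2⟩⟩)
      · exact Or.inr (Finset.mem_inter.2 ⟨h, mem_orderedPairs.2
          ⟨hc', hb', (mem_orderedPairs.1 (hE h)).2.2⟩⟩)
  · rintro ⟨T, E, F⟩ h
    simp only [Finset.mem_sigma, Finset.mem_powerset, Finset.mem_product,
      Finset.mem_filter] at h ⊢
    refine Finset.union_subset (h.2.1.1.trans ?_) (h.2.2.trans ?_)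
    · intro p hp
      rw [mem_orderedPairs] at hp ⊢
      exact ⟨Finset.insert_subset_insert _ h.1 hp.1,
        Finset.insert_subset_insert _ h.1 hp.2.1, hp.2.2⟩
    · intro p hp
      rw [mem_orderedPairs] at hp ⊢
      exact ⟨Finset.mem_insert_of_mem (Finset.sdiff_subset hp.1),
        Finset.mem_insert_of_mem (Finset.sdiff_subset hp.2.1), hp.2.2⟩
  · intro E hE
    rw [Finset.mem_powerset] at hE
    rw [← Finset.inter_union_distrib_left, Finset.inter_eq_left]
    rintro ⟨u, v⟩ hp
    have hV := mem_orderedPairs.1 (hE hp)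
    dsimp only at hV
    rw [Finset.mem_union, mem_orderedPairs, mem_orderedPairs]
    simp only [Finset.mem_insert, Finset.mem_filter, Finset.mem_sdiff] at hV ⊢
    have ho' : Reach E o o := Relation.ReflTransGen.refl
    have huv : Reach E o u ↔ Reach E o v :=
      ⟨fun h => Relation.ReflTransGen.tail h (Or.inl hp),
        fun h => Relation.ReflTransGen.tail h (Or.inr hp)⟩
    have h1 : u = o → Reach E o u := fun h => h ▸ ho'
    have h2 : v = o → Reach E o v := fun h => h ▸ ho'
    tauto
  · rintro ⟨T, E, F⟩ h
    simp only [Finset.mem_sigma, Finset.mem_powerset, Finset.mem_product,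
      Finset.mem_filter] at h
    obtain ⟨hT, ⟨hE, hc⟩, hF⟩ := h
    have hTe : S.filter (Reach (E ∪ F) o) = T := by
      ext v
      rw [Finset.mem_filter]
      constructor
      · rintro ⟨hv, hr⟩
        rcases Finset.mem_insert.1 (hr.mem_of_union hE hF (hdis T)) with rfl | h
        · exact absurd hv ho
        · exact h
      · exact fun hv => ⟨hT hv, (hc v (Finset.mem_insert_of_mem hv)).mono
          Finset.subset_union_left⟩
    simp only [hTe]
    have hE' : (E ∪ F) ∩ orderedPairs (insert o T) = E := by
      rw [Finset.union_inter_distrib_right, Finset.inter_eq_left.2 hE,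
        Finset.disjoint_iff_inter_eq_empty.1 ((hdisP T).symm.mono_left hF), Finset.union_empty]
    have hF' : (E ∪ F) ∩ orderedPairs (S \ T) = F := by
      rw [Finset.union_inter_distrib_right, Finset.inter_eq_left.2 hF,
        Finset.disjoint_iff_inter_eq_empty.1 ((hdisP T).mono_left hE), Finset.empty_union]
    rw [hE', hF']
  · intro E hE
    rw [Finset.mem_powerset] at hE
    rw [← Finset.prod_union]
    · refine Finset.prod_congr ?_ fun _ _ => rfl
      rw [← Finset.inter_union_distrib_left]
      symm
      rw [Finset.inter_eq_left]
      rintro ⟨u, v⟩ hp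
      have hV := mem_orderedPairs.1 (hE hp)
      dsimp only at hV
      rw [Finset.mem_union, mem_orderedPairs, mem_orderedPairs]
      simp only [Finset.mem_insert, Finset.mem_filter, Finset.mem_sdiff] at hV ⊢
      have ho' : Reach E o o := Relation.ReflTransGen.refl
      have huv : Reach E o u ↔ Reach E o v :=
        ⟨fun h => Relation.ReflTransGen.tail h (Or.inl hp),
          fun h => Relation.ReflTransGen.tail h (Or.inr hp)⟩
      have h1 : u = o → Reach E o u := fun h => h ▸ ho'
      have h2 : v = o → Reach E o v := fun h => h ▸ ho'
      tauto
    · exact (hdisP _).mono Finset.inter_subset_right Finset.inter_subset_right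

lemma connSum_insert {a : ι → ι → ℝ} (ha : ∀ i j, a i j = a j i) {o : ι} {T : Finset ι}
    (ho : o ∉ T) : connSum a o (insert o T) = sratio a (fun _ => 1) (a o) T := by
  refine eq_of_conv_eq_on (f := fun T => connSum a o (insert o T)) (boltz_empty a)
    fun S hS => ?_
  have hoS : o ∉ S := fun h => ho (hS h)
  have h := congrFun (conv_sratio ha (fun _ => 1) (a o)) S
  have h' : actBoltz a (fun _ => 1) = boltz a := by ext; simp [actBoltz]
  rw [h'] at h
  rw [h, conv, sum_connSum_mul_boltz a hoS, boltz_insert ha hoS, actBoltz]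
  simp

lemma omegaT_eq_connSum {S : Type*} (w : S → S → ℝ) (n : ℕ) (x : Fin (n + 1) → S) :
    omegaT w (n + 1) x = connSum (fun i j => w (x i) (x j)) 0 Finset.univ := by
  rw [omegaT, connSum, ← Finset.sum_filter]
  have hR : ∀ (G : SimpleGraph (Fin (n + 1))) (E : Finset (Fin (n + 1) × Fin (n + 1))),
      (∀ u v, G.Adj u v ↔ Joined E u v) → (G.Connected ↔ ∀ v, Reach E 0 v) := by
    intro G E h
    have hrel : G.Adj = Joined E := by ext u v; exact h u v
    have : ∀ v, G.Reachable 0 v ↔ Reach E 0 v := by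
      intro v
      rw [SimpleGraph.reachable_iff_reflTransGen, hrel, Reach]
    rw [SimpleGraph.connected_iff_exists_forall_reachable]
    constructor
    · rintro ⟨o, ho⟩ v
      exact (this v).1 ((ho 0).symm.trans (ho v))
    · exact fun hv => ⟨0, fun v => (this v).2 (hv v)⟩
  refine Finset.sum_nbij' (fun G => Finset.univ.filter fun p => p.1 < p.2 ∧ G.Adj p.1 p.2)
    (fun E => SimpleGraph.fromRel fun u v => (u, v) ∈ E) ?_ ?_ ?_ ?_ ?_
  · intro G hG
    simp only [Finset.mem_filter, Finset.mem_univ, true_and, Finset.mem_powerset,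
      true_implies] at hG ⊢
    refine ⟨fun p hp => ?_, (hR G _ fun u v => ?_).1 hG⟩
    · rw [mem_orderedPairs]
      simp only [Finset.mem_filter] at hp
      simp [hp.2.1]
    · simp only [Joined, Finset.mem_filter, Finset.mem_univ, true_and]
      constructor
      · intro h
        rcases lt_or_gt_of_ne h.ne with h' | h'
        · exact Or.inl ⟨h', h⟩
        · exact Or.inr ⟨h', h.symm⟩
      · rintro (h | h)
        · exact h.2
        · exact h.2.symm
  · intro E hE
    simp only [Finset.mem_filter, Finset.mem_univ, true_and, Finset.mem_powerset,
      true_implies] at hE ⊢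
    refine (hR _ E fun u v => ?_).2 hE.2
    rw [SimpleGraph.fromRel_adj, Joined, and_iff_right_iff_imp]
    rintro (h | h)
    · exact (mem_orderedPairs.1 (hE.1 h)).2.2.ne
    · exact (mem_orderedPairs.1 (hE.1 h)).2.2.ne'
  · intro G _
    ext u v
    simp only [SimpleGraph.fromRel_adj, Finset.mem_filter, Finset.mem_univ, true_and]
    constructor
    · rintro ⟨_, h | h⟩
      · exact h.2
      · exact h.2.symm
    · intro h
      refine ⟨h.ne, ?_⟩
      rcases lt_or_gt_of_ne h.ne with h' | h'
      · exact Or.inl ⟨h', h⟩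
      · exact Or.inr ⟨h', h.symm⟩
  · intro E hE
    simp only [Finset.mem_filter, Finset.mem_powerset] at hE
    ext ⟨u, v⟩
    simp only [Finset.mem_filter, Finset.mem_univ, true_and, SimpleGraph.fromRel_adj]
    constructor
    · rintro ⟨h, _, h' | h'⟩
      · exact h'
      · exact absurd h (mem_orderedPairs.1 (hE.1 h')).2.2.not_gt
    · intro h
      have := (mem_orderedPairs.1 (hE.1 h)).2.2
      exact ⟨this, this.ne, Or.inl h⟩
  · intro G _
    rfl

/-- The truncated weight has alternating sign, with absolute value given by `ratio`. -/
lemma omegaT_cons {S : Type*} {w : S → S → ℝ} (hw : ∀ x y, w x y = w y x) (n : ℕ) (o : S)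
    (y : Fin n → S) : omegaT w (n + 1) (Fin.cons o y) = (-1) ^ n *
      ratio (fun i j => w (y i) (y j)) (fun _ => 1) (fun i => w o (y i)) Finset.univ := by
  have huniv : (Finset.univ : Finset (Fin (n + 1))) =
      insert 0 (Finset.univ.map (Fin.succOrderEmb n).toEmbedding) := by
    ext i
    refine Fin.cases ?_ (fun j => ?_) i <;> simp
  rw [omegaT_eq_connSum, huniv, connSum_insert (fun _ _ => hw _ _) (by simp), sratio, ratio_map]
  simp

end ConnectedGraphs

section Forests

variable {ι : Type*} [LinearOrder ι]

/-- The weight of the vertex `i` with children `C`. -/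
def vertexWeight (a : ι → ι → ℝ) (i : ι) (C : Finset ι) : ℝ := (∏ j ∈ C, (1 - a i j)) * boltz a C

lemma vertexWeight_nonneg {a : ι → ι → ℝ} (h0 : ∀ i j, 0 ≤ a i j) (h1 : ∀ i j, a i j ≤ 1) (i : ι)
    (C : Finset ι) : 0 ≤ vertexWeight a i C :=
  mul_nonneg (Finset.prod_nonneg fun _ _ => sub_nonneg.2 (h1 _ _)) (boltz_nonneg h0 C)

lemma prod_le_prod_of_subset_of_le_one {κ : Type*} {f : κ → ℝ} (h0 : ∀ i, 0 ≤ f i)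
    (h1 : ∀ i, f i ≤ 1) {s t : Finset κ} (h : s ⊆ t) : ∏ i ∈ t, f i ≤ ∏ i ∈ s, f i := by
  rw [← Finset.prod_sdiff h]
  exact mul_le_of_le_one_left (Finset.prod_nonneg fun _ _ => h0 _)
    (Finset.prod_le_one (fun _ _ => h0 _) fun _ _ => h1 _)

lemma one_sub_prod_le_sum {κ : Type*} {f : κ → ℝ} (h0 : ∀ i, 0 ≤ f i) (h1 : ∀ i, f i ≤ 1)
    (s : Finset κ) : 1 - ∏ i ∈ s, f i ≤ ∑ i ∈ s, (1 - f i) := by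
  induction s using Finset.induction_on with
  | empty => simp
  | insert i s hi ih =>
    rw [Finset.prod_insert hi, Finset.sum_insert hi]
    have := Finset.prod_le_one (s := s) (fun i _ => h0 i) fun i _ => h1 i
    nlinarith [h1 i, h0 i]

lemma boltz_le_prod_fibers {a : ι → ι → ℝ} (h0 : ∀ i j, 0 ≤ a i j) (h1 : ∀ i j, a i j ≤ 1)
    (f : ι → ι) (S X : Finset ι) : boltz a S ≤ ∏ x ∈ X, boltz a (S.filter fun s => f s = x) := by
  simp only [boltz]
  rw [← Finset.prod_biUnion]
  · refine prod_le_prod_of_subset_of_le_one (fun p => h0 _ _) (fun p => h1 _ _) fun p hp => ?_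
    simp only [Finset.mem_biUnion, mem_orderedPairs, Finset.mem_filter] at hp ⊢
    obtain ⟨x, _, hp⟩ := hp
    exact ⟨hp.1.1, hp.2.1.1, hp.2.2⟩
  · intro x _ y _ hxy
    rw [Function.onFun, Finset.disjoint_left]
    intro p hp hq
    simp only [mem_orderedPairs, Finset.mem_filter] at hp hq
    exact hxy (hp.1.2.symm.trans hq.1.2)

variable [Fintype ι]

/-- Functions assigning to each element of `S` an element of `X`, trivial off `S`. -/
def parentMaps (S X : Finset ι) : Finset (ι → ι) :=
  Fintype.piFinset fun t => if t ∈ S then X else {t}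

lemma mem_parentMaps {S X : Finset ι} {f : ι → ι} :
    f ∈ parentMaps S X ↔ (∀ t ∈ S, f t ∈ X) ∧ ∀ t ∉ S, f t = t := by
  rw [parentMaps, Fintype.mem_piFinset]
  constructor
  · intro h
    exact ⟨fun t ht => by simpa [ht] using h t, fun t ht => by simpa [ht] using h t⟩
  · rintro ⟨h, h'⟩ t
    by_cases ht : t ∈ S
    · simpa [ht] using h t ht
    · simpa [ht] using h' t ht

lemma generation_le {a : ι → ι → ℝ} (h0 : ∀ i j, 0 ≤ a i j) (h1 : ∀ i j, a i j ≤ 1)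
    (S X : Finset ι) : (∏ s ∈ S, (1 - ∏ x ∈ X, a x s)) * boltz a S ≤
      ∑ f ∈ parentMaps S X, ∏ x ∈ X, vertexWeight a x (S.filter fun s => f s = x) := by
  have h : ∏ s ∈ S, (1 - ∏ x ∈ X, a x s) ≤ ∏ s ∈ S, ∑ x ∈ X, (1 - a x s) := by
    refine Finset.prod_le_prod (fun s _ => sub_nonneg.2 ?_) fun s _ => ?_
    · exact Finset.prod_le_one (fun _ _ => h0 _ _) fun _ _ => h1 _ _
    · exact one_sub_prod_le_sum (fun _ => h0 _ _) (fun _ => h1 _ _) X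
  have h2 : ∏ s ∈ S, ∑ x ∈ X, (1 - a x s) =
      ∑ f ∈ parentMaps S X, ∏ s ∈ S, (1 - a (f s) s) := by
    have := Finset.prod_univ_sum (fun t : ι => if t ∈ S then X else {t})
      (fun t x => if t ∈ S then 1 - a x t else 1)
    rw [parentMaps]
    simp only [Finset.prod_ite_mem, Finset.univ_inter] at this
    rw [← this, ← Finset.univ_inter S, ← Finset.prod_ite_mem, Finset.univ_inter]
    refine Finset.prod_congr rfl fun t _ => ?_
    by_cases ht : t ∈ S <;> simp [ht]
  refine (mul_le_mul_of_nonneg_right h (boltz_nonneg h0 S)).trans ?_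
  rw [h2, Finset.sum_mul]
  refine Finset.sum_le_sum fun f hf => ?_
  simp only [vertexWeight, Finset.prod_mul_distrib]
  have h3 : ∏ s ∈ S, (1 - a (f s) s) =
      ∏ x ∈ X, ∏ s ∈ S with f s = x, (1 - a x s) := by
    rw [← Finset.prod_fiberwise_of_maps_to (mem_parentMaps.1 hf).1]
    refine Finset.prod_congr rfl fun x _ => Finset.prod_congr rfl fun s hs => ?_
    rw [(Finset.mem_filter.1 hs).2]
  rw [h3]
  exact mul_le_mul_of_nonneg_left (boltz_le_prod_fibers h0 h1 f S X)
    (Finset.prod_nonneg fun _ _ => Finset.prod_nonneg fun _ _ => sub_nonneg.2 (h1 _ _))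

/-- Parent maps of forests with vertex set `X ∪ T` and set of roots `X`. -/
def forests (X T : Finset ι) : Finset (ι → ι) :=
  (parentMaps T (X ∪ T)).filter fun p => ∃ l : ι → ℕ, ∀ t ∈ T, l (p t) < l t

/-- The product of the vertex weights of a forest. -/
def forestWeight (a : ι → ι → ℝ) (X T : Finset ι) (p : ι → ι) : ℝ :=
  ∏ i ∈ X ∪ T, vertexWeight a i (T.filter fun t => p t = i)

lemma ratio_le_sum_forests {a : ι → ι → ℝ} (h0 : ∀ i j, 0 ≤ a i j) (h1 : ∀ i j, a i j ≤ 1)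
    {X T : Finset ι} (hXT : Disjoint X T) :
    ratio a (fun _ => 1) (fun t => ∏ x ∈ X, a x t) T ≤
      ∑ p ∈ forests X T, forestWeight a X T p := by
  induction hn : T.card using Nat.strong_induction_on generalizing X T with
  | _ n ih =>
    subst hn
    have hnn : ∀ (X T : Finset ι) (p : ι → ι), 0 ≤ forestWeight a X T p := fun X T p =>
      Finset.prod_nonneg fun _ _ => vertexWeight_nonneg h0 h1 _ _
    by_cases hT : T = ∅
    · subst hT
      rw [ratio_empty]
      have hid : (id : ι → ι) ∈ forests X ∅ := by
        rw [forests, Finset.mem_filter, mem_parentMaps]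
        simp
      refine le_trans ?_ (Finset.single_le_sum (fun p _ => hnn X ∅ p) hid)
      simp [forestWeight, vertexWeight]
    rw [ratio_of_ne_empty _ _ _ hT]
    have step : ∀ S ∈ T.powerset.erase ∅, (∏ s ∈ S, (1 - ∏ x ∈ X, a x s) * 1) * boltz a S *
        ratio a (fun _ => 1) (fun t => ∏ s ∈ S, a s t) (T \ S) ≤
        ∑ q ∈ parentMaps S X ×ˢ forests S (T \ S),
          (∏ x ∈ X, vertexWeight a x (S.filter fun s => q.1 s = x)) *
            forestWeight a S (T \ S) q.2 := by
      intro S hS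
      simp only [Finset.mem_erase, Finset.mem_powerset] at hS
      rw [Finset.sum_product' _ _ fun (f p : ι → ι) => (∏ x ∈ X, vertexWeight a x
        (S.filter fun s => f s = x)) * forestWeight a S (T \ S) p, ← Finset.sum_mul_sum]
      simp only [mul_one]
      refine mul_le_mul (generation_le h0 h1 S X) (ih _ (Finset.card_lt_card
        (Finset.sdiff_ssubset hS.2 (Finset.nonempty_iff_ne_empty.2 hS.1)))
        Finset.disjoint_sdiff rfl) (ratio_nonneg h0 h1 (fun _ => zero_le_one)
        (fun i => Finset.prod_le_one (fun _ _ => h0 _ _) fun _ _ => h1 _ _) _)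
        (Finset.sum_nonneg fun _ _ => Finset.prod_nonneg fun _ _ => vertexWeight_nonneg h0 h1 _ _)
    refine (Finset.sum_le_sum step).trans ?_
    rw [Finset.sum_sigma']
    set D := (T.powerset.erase ∅).sigma fun S => parentMaps S X ×ˢ forests S (T \ S) with hD
    let g : (Σ _ : Finset ι, (ι → ι) × (ι → ι)) → ι → ι :=
      fun x t => if t ∈ x.1 then x.2.1 t else x.2.2 t
    have hmem : ∀ x ∈ D, x.1 ⊆ T ∧ ((∀ t ∈ x.1, x.2.1 t ∈ X) ∧ ∀ t ∉ x.1, x.2.1 t = t) ∧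
        ((∀ t ∈ T \ x.1, x.2.2 t ∈ T) ∧ ∀ t ∉ T \ x.1, x.2.2 t = t) ∧
        ∃ l : ι → ℕ, ∀ t ∈ T \ x.1, l (x.2.2 t) < l t := by
      rintro ⟨S, f, p⟩ hx
      simp only [hD, Finset.mem_sigma, Finset.mem_erase, Finset.mem_powerset,
        Finset.mem_product, forests, Finset.mem_filter, mem_parentMaps] at hx
      have := Finset.union_sdiff_of_subset hx.1.2
      rw [this] at hx
      exact ⟨hx.1.2, hx.2.1, hx.2.2.1, hx.2.2.2⟩
    have hX : ∀ t ∈ T, t ∉ X := fun t ht hx => Finset.disjoint_left.1 hXT hx ht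
    have hroot : ∀ x ∈ D, x.1 = T.filter fun t => g x t ∈ X := by
      intro x hx
      obtain ⟨hS, hf, hp, -⟩ := hmem x hx
      ext t
      rw [Finset.mem_filter]
      refine ⟨fun ht => ⟨hS ht, by simpa [g, ht] using hf.1 t ht⟩, fun ⟨ht, hgt⟩ => ?_⟩
      by_contra hn
      simp only [g, hn, if_false] at hgt
      exact hX _ (hp.1 t (Finset.mem_sdiff.2 ⟨ht, hn⟩)) hgt
    have hinj : Set.InjOn g D := by
      rintro x hx y hy hxy
      have h12 : x.1 = y.1 := by rw [hroot x hx, hroot y hy, hxy]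
      obtain ⟨hS, hf, hp, -⟩ := hmem x hx
      obtain ⟨hS', hf', hp', -⟩ := hmem y hy
      obtain ⟨S, f, p⟩ := x
      obtain ⟨S', f', p'⟩ := y
      dsimp only at *
      subst h12
      have hff : f = f' := by
        ext t
        by_cases ht : t ∈ S
        · simpa [g, ht] using congrFun hxy t
        · rw [hf.2 t ht, hf'.2 t ht]
      have hpp : p = p' := by
        ext t
        by_cases ht : t ∈ S
        · rw [hp.2 t (by simp [ht]), hp'.2 t (by simp [ht])]
        · simpa [g, ht] using congrFun hxy t
      rw [hff, hpp]
    have hval : ∀ x ∈ D, (∏ i ∈ X, vertexWeight a i (x.1.filter fun s => x.2.1 s = i)) *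
        forestWeight a x.1 (T \ x.1) x.2.2 = forestWeight a X T (g x) := by
      intro x hx
      obtain ⟨hS, hf, hp, -⟩ := hmem x hx
      rw [forestWeight, forestWeight, Finset.prod_union hXT, Finset.union_sdiff_of_subset hS]
      congr 1
      · refine Finset.prod_congr rfl fun i hi => ?_
        congr 1
        ext t
        simp only [Finset.mem_filter, g]
        by_cases ht : t ∈ x.1
        · simp [ht, hS ht]
        · simp only [ht, false_and, if_false, false_iff, not_and]
          rintro htT rfl
          exact hX _ (hp.1 t (Finset.mem_sdiff.2 ⟨htT, ht⟩)) hi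
      · refine Finset.prod_congr rfl fun i hi => ?_
        congr 1
        ext t
        simp only [Finset.mem_filter, g, Finset.mem_sdiff]
        by_cases ht : t ∈ x.1
        · simp only [ht, not_true_eq_false, and_false, false_and, if_true, false_iff, not_and]
          rintro htT rfl
          exact hX _ hi (hf.1 t ht)
        · simp [ht]
    rw [Finset.sum_congr rfl hval, ← Finset.sum_image hinj]
    refine Finset.sum_le_sum_of_subset_of_nonneg ?_ fun p _ _ => hnn X T p
    intro p hp
    obtain ⟨x, hx, rfl⟩ := Finset.mem_image.1 hp
    obtain ⟨hS, hf, hp, l, hl⟩ := hmem x hx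
    rw [forests, Finset.mem_filter, mem_parentMaps]
    refine ⟨⟨fun t ht => ?_, fun t ht => ?_⟩, fun i => if i ∈ X then 0 else l i + 1,
      fun t ht => ?_⟩
    · rw [Finset.mem_union]
      by_cases hts : t ∈ x.1
      · left; simpa [g, hts] using hf.1 t hts
      · right; simpa [g, hts] using hp.1 t (Finset.mem_sdiff.2 ⟨ht, hts⟩)
    · have hts : t ∉ x.1 := fun h => ht (hS h)
      simpa [g, hts] using hp.2 t (by simp [ht])
    · dsimp only
      rw [if_neg (hX t ht)]
      by_cases hts : t ∈ x.1
      · have : g x t ∈ X := by simpa [g, hts] using hf.1 t hts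
        simp [this]
      · have ht' := Finset.mem_sdiff.2 ⟨ht, hts⟩
        have hg : g x t = x.2.2 t := by simp [g, hts]
        have := hl t ht'
        rw [hg, if_neg (hX _ (hp.1 t ht'))]
        omega

end Forests

section Trees

variable {n : ℕ}

/-- The graph joining each vertex to its parent. -/
def parentGraph (p : Fin (n + 1) → Fin (n + 1)) : SimpleGraph (Fin (n + 1)) :=
  SimpleGraph.fromRel fun u v => p u = v

/-- A parent map on `Fin (n + 1)` with root `0`. -/
def IsParentMap (p : Fin (n + 1) → Fin (n + 1)) : Prop :=
  p 0 = 0 ∧ ∃ D : Fin (n + 1) → ℕ, D 0 = 0 ∧ ∀ t, t ≠ 0 → D t = D (p t) + 1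

lemma isParentMap_of_mem_forests {p : Fin (n + 1) → Fin (n + 1)}
    (hp : p ∈ forests {0} (Finset.univ.erase 0)) : IsParentMap p := by
  rw [forests, Finset.mem_filter, mem_parentMaps] at hp
  obtain ⟨⟨-, h0⟩, l, hl⟩ := hp
  have hp0 : p 0 = 0 := h0 0 (by simp)
  have hex : ∀ t, ∃ k, p^[k] t = 0 := by
    intro t
    induction hk : l t using Nat.strong_induction_on generalizing t with
    | _ k ih =>
      by_cases ht : t = 0
      · exact ⟨0, ht⟩
      · obtain ⟨m, hm⟩ := ih (l (p t)) (hk ▸ hl t (by simp [ht])) (p t) rfl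
        exact ⟨m + 1, hm⟩
  refine ⟨hp0, fun t => Nat.find (hex t), ?_, fun t ht => ?_⟩
  · rw [Nat.find_eq_zero]; rfl
  · exact Nat.find_comp_succ (hex t) (hex (p t)) ht

lemma IsParentMap.adj_cases {p : Fin (n + 1) → Fin (n + 1)} (hp : IsParentMap p)
    {u v : Fin (n + 1)} (h : (parentGraph p).Adj u v) :
    (u ≠ 0 ∧ p u = v) ∨ (v ≠ 0 ∧ p v = u) := by
  rw [parentGraph, SimpleGraph.fromRel_adj] at h
  obtain ⟨hne, h | h⟩ := h
  · refine Or.inl ⟨?_, h⟩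
    rintro rfl
    exact hne (hp.1.symm.trans h)
  · refine Or.inr ⟨?_, h⟩
    rintro rfl
    exact hne (h.symm.trans hp.1)

lemma IsParentMap.adj_parent {p : Fin (n + 1) → Fin (n + 1)} (hp : IsParentMap p)
    {t : Fin (n + 1)} (ht : t ≠ 0) : (parentGraph p).Adj (p t) t := by
  obtain ⟨-, D, -, hD⟩ := hp
  rw [parentGraph, SimpleGraph.fromRel_adj]
  refine ⟨fun h => ?_, Or.inr rfl⟩
  have := hD t ht
  rw [h] at this
  omega

lemma IsParentMap.connected {p : Fin (n + 1) → Fin (n + 1)} (hp : IsParentMap p) :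
    (parentGraph p).Connected ∧ ∀ t, t ≠ 0 →
      (parentGraph p).dist 0 t = (parentGraph p).dist 0 (p t) + 1 := by
  obtain ⟨D, hD0, hD⟩ := hp.2
  have hwalk : ∀ k t, D t = k → ∃ w : (parentGraph p).Walk 0 t, w.length = k := by
    intro k
    induction k with
    | zero =>
      intro t ht
      have : t = 0 := by
        by_contra h
        have := hD t h
        omega
      subst this
      exact ⟨SimpleGraph.Walk.nil, rfl⟩
    | succ k ih =>
      intro t ht
      have ht0 : t ≠ 0 := by rintro rfl; omega
      obtain ⟨w, hw⟩ := ih (p t) (by have := hD t ht0; omega)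
      exact ⟨w.concat (hp.adj_parent ht0), by simp [hw]⟩
  have hlen : ∀ {u v : Fin (n + 1)} (w : (parentGraph p).Walk u v), D v ≤ D u + w.length := by
    intro u v w
    induction w with
    | nil => simp
    | cons h w ih =>
      rw [SimpleGraph.Walk.length_cons]
      rcases hp.adj_cases h with ⟨h0, h1⟩ | ⟨h0, h1⟩
      · have := hD _ h0
        rw [h1] at this
        omega
      · have := hD _ h0
        rw [h1] at this
        omega
  have hconn : (parentGraph p).Connected := by
    rw [SimpleGraph.connected_iff_exists_forall_reachable]
    exact ⟨0, fun v => ⟨(hwalk _ v rfl).choose⟩⟩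
  have hdist : ∀ t, (parentGraph p).dist 0 t = D t := by
    intro t
    obtain ⟨w, hw⟩ := hwalk _ t rfl
    refine le_antisymm (hw ▸ SimpleGraph.dist_le w) ?_
    obtain ⟨w', hw'⟩ := hconn.exists_walk_length_eq_dist 0 t
    have := hlen w'
    omega
  exact ⟨hconn, fun t ht => by rw [hdist, hdist, hD t ht]⟩

lemma IsParentMap.isTree {p : Fin (n + 1) → Fin (n + 1)} (hp : IsParentMap p) :
    (parentGraph p).IsTree := by
  rw [SimpleGraph.isTree_iff_connected_and_card]
  refine ⟨hp.connected.1, le_antisymm ?_ hp.connected.1.card_vert_le_card_edgeSet_add_one⟩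
  have hsurj : Function.Surjective (fun t : {t : Fin (n + 1) // t ≠ 0} =>
      (⟨s(p t.1, t.1), hp.adj_parent t.2⟩ : (parentGraph p).edgeSet)) := by
    rintro ⟨e, he⟩
    induction e using Sym2.ind with
    | _ u v =>
      rcases hp.adj_cases he with ⟨h0, h1⟩ | ⟨h0, h1⟩
      · exact ⟨⟨u, h0⟩, by simp [h1, Sym2.eq_swap]⟩
      · exact ⟨⟨v, h0⟩, by simp [h1]⟩
  have : Nat.card (parentGraph p).edgeSet ≤ _ := Nat.card_le_card_of_surjective _ hsurj
  have h2 : Nat.card {t : Fin (n + 1) // t ≠ 0} = n := by simp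
  rw [Nat.card_fin]
  omega

lemma IsParentMap.mem_childrenF {p : Fin (n + 1) → Fin (n + 1)} (hp : IsParentMap p)
    {i j : Fin (n + 1)} : j ∈ childrenF (parentGraph p) i ↔ j ≠ 0 ∧ p j = i := by
  have hd := hp.connected.2
  simp only [childrenF, Finset.mem_filter, Finset.mem_univ, true_and]
  constructor
  · rintro ⟨hadj, hdist⟩
    rcases hp.adj_cases hadj with ⟨h0, h1⟩ | h
    · have := hd i h0
      rw [h1] at this
      omega
    · exact h
  · rintro ⟨h0, rfl⟩
    exact ⟨hp.adj_parent h0, hd j h0⟩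

lemma parentGraph_injOn : Set.InjOn (parentGraph (n := n)) {p | IsParentMap p} := by
  intro p hp q hq h
  ext1 t
  by_cases ht : t = 0
  · rw [ht, hp.1, hq.1]
  · have : t ∈ childrenF (parentGraph p) (p t) := hp.mem_childrenF.2 ⟨ht, rfl⟩
    rw [h, hq.mem_childrenF] at this
    exact this.2.symm

/-- Penrose-type bound of the truncated weight by the tree sum. -/
lemma ratio_le_treeB {S : Type*} {w : S → S → ℝ} (h0 : ∀ x y, 0 ≤ w x y) (h1 : ∀ x y, w x y ≤ 1)
    (o : S) (y : Fin n → S) :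
    ratio (fun i j => w (y i) (y j)) (fun _ => 1) (fun i => w o (y i)) Finset.univ ≤
      treeB w n (Fin.cons o y) := by
  set x : Fin (n + 1) → S := Fin.cons o y with hx
  set a : Fin (n + 1) → Fin (n + 1) → ℝ := fun i j => w (x i) (x j) with ha
  have huniv : Finset.univ.erase (0 : Fin (n + 1)) =
      Finset.univ.map (Fin.succOrderEmb n).toEmbedding := by
    ext i
    refine Fin.cases ?_ (fun j => ?_) i <;> simp
  have h2 : ratio (fun i j => w (y i) (y j)) (fun _ => 1) (fun i => w o (y i)) Finset.univ =
      ratio a (fun _ => 1) (fun t => ∏ x ∈ {0}, a x t) (Finset.univ.erase 0) := by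
    rw [huniv, ratio_map]
    simp [ha, hx]
  rw [h2]
  refine (ratio_le_sum_forests (fun _ _ => h0 _ _) (fun _ _ => h1 _ _) (by simp)).trans ?_
  have hval : ∀ p ∈ forests {0} (Finset.univ.erase (0 : Fin (n + 1))),
      forestWeight a {0} (Finset.univ.erase 0) p =
        ∏ i, phiFinset w (x i) (childrenF (parentGraph p) i) x := by
    intro p hp
    have hp' := isParentMap_of_mem_forests hp
    have hu : ({0} : Finset (Fin (n + 1))) ∪ Finset.univ.erase 0 = Finset.univ := by
      ext i; simp
    rw [forestWeight, hu]
    refine Finset.prod_congr rfl fun i _ => ?_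
    have : (Finset.univ.erase 0).filter (fun t => p t = i) = childrenF (parentGraph p) i := by
      ext j
      rw [hp'.mem_childrenF]
      simp
    rw [this]
    rfl
  rw [Finset.sum_congr rfl hval, treeB, ← Finset.sum_filter,
    ← Finset.sum_image (f := fun τ => ∏ i, phiFinset w (x i) (childrenF τ i) x)
      (g := parentGraph)]
  · refine Finset.sum_le_sum_of_subset_of_nonneg ?_ fun τ _ _ => ?_
    · intro τ hτ
      obtain ⟨p, hp, rfl⟩ := Finset.mem_image.1 hτ
      simpa using (isParentMap_of_mem_forests hp).isTree
    · exact Finset.prod_nonneg fun i _ => mul_nonneg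
        (Finset.prod_nonneg fun _ _ => sub_nonneg.2 (h1 _ _))
        (Finset.prod_nonneg fun _ _ => h0 _ _)
  · exact parentGraph_injOn.mono fun p hp => isParentMap_of_mem_forests hp

end Trees

section Renewal

lemma ratio_renewal {ι : Type*} [LinearOrder ι] {a : ι → ι → ℝ} (ha : ∀ i j, a i j = a j i)
    (r : ι → ℝ) {T : Finset ι} (hT : T ≠ ∅) :
    ratio a (fun _ => 1) r T = ∑ U ∈ T.powerset, ∑ m ∈ U, ((1 - r m) *
      ratio a (a m) (fun t => if t < m then r t else 1) (U.erase m)) *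
        ratio a (fun _ => 1) (a m) (T \ U) := by
  have h : ratio a (fun _ => 1) r T = ∑ m ∈ T, ∑ V ∈ (T.erase m).powerset, ((1 - r m) *
      ratio a (a m) (fun t => if t < m then r t else 1) V) *
        ratio a (fun _ => 1) (a m) (T.erase m \ V) := by
    have h1 := sratio_ordered ha r T
    rw [if_neg hT, zero_sub, sratio] at h1
    have h2 : ∀ m ∈ T, (1 - r m) *
        sratio a (fun _ => 1) (fun t => (if t < m then r t else 1) * a m t) (T.erase m) =
        -((-1) ^ T.card * ∑ V ∈ (T.erase m).powerset, ((1 - r m) *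
          ratio a (a m) (fun t => if t < m then r t else 1) V) *
          ratio a (fun _ => 1) (a m) (T.erase m \ V)) := by
      intro m hm
      rw [sratio_mul ha, conv, Finset.mul_sum, Finset.mul_sum, ← Finset.sum_neg_distrib]
      refine Finset.sum_congr rfl fun V hV => ?_
      rw [Finset.mem_powerset] at hV
      have hc : T.card = V.card + (T.erase m \ V).card + 1 := by
        rw [add_comm V.card, Finset.card_sdiff_add_card_eq_card hV, Finset.card_erase_add_one hm]
      simp only [sratio, mul_one]
      rw [hc, pow_succ, pow_add]
      ring
    rw [Finset.sum_congr rfl h2, Finset.sum_neg_distrib, neg_neg, ← Finset.mul_sum] at h1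
    exact mul_left_cancel₀ (pow_ne_zero _ (by norm_num)) h1
  rw [h, Finset.sum_sigma', Finset.sum_sigma']
  refine Finset.sum_bij' (fun x _ => ⟨insert x.1 x.2, x.1⟩) (fun x _ => ⟨x.2, x.1.erase x.2⟩)
    ?_ ?_ ?_ ?_ ?_
  · rintro ⟨m, V⟩ hx
    simp only [Finset.mem_sigma, Finset.mem_powerset] at hx ⊢
    exact ⟨Finset.insert_subset hx.1 (hx.2.trans (Finset.erase_subset _ _)),
      Finset.mem_insert_self _ _⟩
  · rintro ⟨U, m⟩ hx
    simp only [Finset.mem_sigma, Finset.mem_powerset] at hx ⊢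
    exact ⟨hx.1 hx.2, Finset.erase_subset_erase _ hx.1⟩
  · rintro ⟨m, V⟩ hx
    simp only [Finset.mem_sigma, Finset.mem_powerset] at hx
    have : m ∉ V := fun h => Finset.notMem_erase m T (hx.2 h)
    simp [Finset.erase_insert this]
  · rintro ⟨U, m⟩ hx
    simp only [Finset.mem_sigma] at hx
    simp [Finset.insert_erase hx.2]
  · rintro ⟨m, V⟩ hx
    simp only [Finset.mem_sigma, Finset.mem_powerset] at hx
    have : m ∉ V := fun h => Finset.notMem_erase m T (hx.2 h)
    dsimp only
    rw [Finset.erase_insert this, Finset.erase_sdiff_comm, Finset.sdiff_insert]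

/-- A measurable, symmetric, translation-invariant pair weight with values in `[0,1]`. -/
structure IsPairWeight {d : ℕ} (w : (Fin d → ℝ) → (Fin d → ℝ) → ℝ) : Prop where
  measurable : Measurable fun p : (Fin d → ℝ) × (Fin d → ℝ) => w p.1 p.2
  nonneg : ∀ x y, 0 ≤ w x y
  le_one : ∀ x y, w x y ≤ 1
  symm : ∀ x y, w x y = w y x
  add_right : ∀ x y z, w (x + z) (y + z) = w x y

variable {d : ℕ} {w : (Fin d → ℝ) → (Fin d → ℝ) → ℝ}

/-- The integral of the absolute value of the truncated weight of a configuration indexed by `ι`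
rooted at `0`. -/
def cluster (w : (Fin d → ℝ) → (Fin d → ℝ) → ℝ) (ι : Type) [LinearOrder ι] [Fintype ι] : ℝ≥0∞ :=
  ∫⁻ y : ι → Fin d → ℝ, ENNReal.ofReal
    (ratio (fun i j => w (y i) (y j)) (fun _ => 1) (fun i => w 0 (y i)) Finset.univ)

/-- The density of a block of the renewal decomposition of `cluster`. -/
def blockDensity (w : (Fin d → ℝ) → (Fin d → ℝ) → ℝ) {ι : Type} [LinearOrder ι] [Fintype ι]
    (m : ι) (y : ι → Fin d → ℝ) : ℝ :=
  (1 - w 0 (y m)) * ratio (fun i j => w (y i) (y j)) (fun i => w (y m) (y i))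
    (fun i => if i < m then w 0 (y i) else 1) (Finset.univ.erase m)

/-- The total weight of a block of the renewal decomposition of `cluster`. -/
def block (w : (Fin d → ℝ) → (Fin d → ℝ) → ℝ) (ι : Type) [LinearOrder ι] [Fintype ι] : ℝ≥0∞ :=
  ∫⁻ y : ι → Fin d → ℝ, ∑ m, ENNReal.ofReal (blockDensity w m y)

lemma lintegral_piCongrLeft {ι κ : Type} [Fintype ι] [Fintype κ] (e : κ ≃ ι)
    (f : (κ → Fin d → ℝ) → ℝ≥0∞) :
    ∫⁻ y : ι → Fin d → ℝ, f (fun k => y (e k)) = ∫⁻ y : κ → Fin d → ℝ, f y := by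
  have h := (volume_measurePreserving_piCongrLeft (fun _ : ι => Fin d → ℝ) e).symm
  have := h.lintegral_comp_emb (MeasurableEquiv.measurableEmbedding _) f
  rw [← this]
  rfl

lemma cluster_congr {ι κ : Type} [LinearOrder ι] [Fintype ι] [LinearOrder κ] [Fintype κ]
    (e : κ ≃o ι) : cluster w ι = cluster w κ := by
  rw [cluster, cluster, ← lintegral_piCongrLeft e.toEquiv]
  congr with y
  have : (Finset.univ : Finset ι) = Finset.univ.map e.toOrderEmbedding.toEmbedding := by
    ext i; simpa using e.surjective i
  rw [this, ratio_map]
  rfl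

lemma block_congr {ι κ : Type} [LinearOrder ι] [Fintype ι] [LinearOrder κ] [Fintype κ]
    (e : κ ≃o ι) : block w ι = block w κ := by
  rw [block, block, ← lintegral_piCongrLeft e.toEquiv]
  congr with y
  rw [← e.toEquiv.sum_comp]
  refine Finset.sum_congr rfl fun m _ => ?_
  have : (Finset.univ.erase (e.toEquiv m)) =
      (Finset.univ.erase m).map e.toOrderEmbedding.toEmbedding := by
    ext i
    obtain ⟨k, rfl⟩ := e.surjective i
    simp
  rw [blockDensity, this, ratio_map]
  simp [blockDensity]

lemma IsPairWeight.measurable_comp (hw : IsPairWeight w) {Ω : Type*} [MeasurableSpace Ω]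
    {f g : Ω → Fin d → ℝ} (hf : Measurable f) (hg : Measurable g) :
    Measurable fun ω => w (f ω) (g ω) :=
  hw.measurable.comp (hf.prodMk hg)

lemma IsPairWeight.measurable_blockDensity (hw : IsPairWeight w) {ι : Type} [LinearOrder ι]
    [Fintype ι] (m : ι) : Measurable (blockDensity w m) := by
  refine (measurable_const.sub (hw.measurable_comp measurable_const (measurable_pi_apply m))).mul
    (measurable_ratio
      (fun i j => hw.measurable_comp (measurable_pi_apply i) (measurable_pi_apply j))
      (fun i => hw.measurable_comp (measurable_pi_apply m) (measurable_pi_apply i))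
      (fun i => ?_) _)
  split_ifs
  · exact hw.measurable_comp measurable_const (measurable_pi_apply i)
  · exact measurable_const

lemma IsPairWeight.ratio_nonneg (hw : IsPairWeight w) {ι : Type} [LinearOrder ι] (x : Fin d → ℝ)
    (y : ι → Fin d → ℝ) (T : Finset ι) :
    0 ≤ ratio (fun i j => w (y i) (y j)) (fun _ => 1) (fun i => w x (y i)) T :=
  TreeBound.ratio_nonneg (fun _ _ => hw.nonneg _ _) (fun _ _ => hw.le_one _ _)
    (fun _ => zero_le_one) (fun _ => hw.le_one _ _) T

lemma IsPairWeight.blockDensity_nonneg (hw : IsPairWeight w) {ι : Type} [LinearOrder ι] [Fintype ι]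
    (m : ι) (y : ι → Fin d → ℝ) : 0 ≤ blockDensity w m y := by
  refine mul_nonneg (sub_nonneg.2 (hw.le_one _ _)) (TreeBound.ratio_nonneg
    (fun _ _ => hw.nonneg _ _) (fun _ _ => hw.le_one _ _) (fun _ => hw.nonneg _ _) (fun i => ?_) _)
  split_ifs
  · exact hw.le_one _ _
  · exact le_rfl

lemma IsPairWeight.lintegral_ratio (hw : IsPairWeight w) (ι : Type) [LinearOrder ι] [Fintype ι]
    (x : Fin d → ℝ) : ∫⁻ y : ι → Fin d → ℝ, ENNReal.ofReal (ratio (fun i j => w (y i) (y j))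
      (fun _ => 1) (fun i => w x (y i)) Finset.univ) = cluster w ι := by
  refine Eq.symm ((lintegral_sub_right_eq_self _ fun _ : ι => x).symm.trans ?_)
  refine lintegral_congr fun y => ?_
  have h1 : ∀ y z, w (y - x) (z - x) = w y z := fun y z => by
    rw [sub_eq_add_neg, sub_eq_add_neg, hw.add_right]
  have h2 : ∀ y, w 0 (y - x) = w x y := fun y => by
    rw [← h1 x, sub_self]
  simp only [Pi.sub_apply, h1, h2]

lemma IsPairWeight.lintegral_block_mul_cluster (hw : IsPairWeight w) (ι κ : Type) [LinearOrder ι]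
    [Fintype ι] [LinearOrder κ] [Fintype κ] :
    ∫⁻ z : (ι → Fin d → ℝ) × (κ → Fin d → ℝ), ∑ m, ENNReal.ofReal (blockDensity w m z.1) *
      ENNReal.ofReal (ratio (fun i j => w (z.2 i) (z.2 j)) (fun _ => 1)
        (fun i => w (z.1 m) (z.2 i)) Finset.univ) = block w ι * cluster w κ := by
  have hm1 : ∀ i : κ, Measurable fun z : (ι → Fin d → ℝ) × (κ → Fin d → ℝ) => z.2 i :=
    fun i => (measurable_pi_apply i).comp measurable_snd
  have hm2 : ∀ i : ι, Measurable fun z : (ι → Fin d → ℝ) × (κ → Fin d → ℝ) => z.1 i :=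
    fun i => (measurable_pi_apply i).comp measurable_fst
  have hr : ∀ m : ι, Measurable fun z : (ι → Fin d → ℝ) × (κ → Fin d → ℝ) =>
      ENNReal.ofReal (ratio (fun i j => w (z.2 i) (z.2 j)) (fun _ => 1)
        (fun i => w (z.1 m) (z.2 i)) Finset.univ) := fun m =>
    (measurable_ratio (fun i j => hw.measurable_comp (hm1 i) (hm1 j))
      (fun _ => measurable_const) (fun i => hw.measurable_comp (hm2 m) (hm1 i)) _).ennreal_ofReal
  have hb : ∀ m : ι, Measurable fun y => ENNReal.ofReal (blockDensity w m y) := fun m =>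
    (hw.measurable_blockDensity m).ennreal_ofReal
  have hr' : ∀ (m : ι) (u : ι → Fin d → ℝ), Measurable fun v : κ → Fin d → ℝ =>
      ENNReal.ofReal (ratio (fun i j => w (v i) (v j)) (fun _ => 1)
        (fun i => w (u m) (v i)) Finset.univ) := fun m u =>
    (hr m).comp (measurable_const.prodMk measurable_id)
  rw [Measure.volume_eq_prod, lintegral_prod, block,
    ← lintegral_mul_const _ (Finset.measurable_sum _ fun m _ => hb m)]
  · refine lintegral_congr fun u => ?_
    dsimp only
    rw [lintegral_finsetSum _ fun m _ => (hr' m u).const_mul _, Finset.sum_mul]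
    refine Finset.sum_congr rfl fun m _ => ?_
    rw [lintegral_const_mul _ (hr' m u), hw.lintegral_ratio]
  · exact (Finset.measurable_sum _ fun m _ =>
      ((hb m).comp measurable_fst).mul (hr m)).aemeasurable

lemma IsPairWeight.lintegral_split (hw : IsPairWeight w) {ι : Type} [LinearOrder ι] [Fintype ι]
    (U : Finset ι) :
    ∫⁻ y : ι → Fin d → ℝ, ∑ m ∈ U, ENNReal.ofReal (((1 - w 0 (y m)) *
      ratio (fun i j => w (y i) (y j)) (fun i => w (y m) (y i))
        (fun t => if t < m then w 0 (y t) else 1) (U.erase m)) *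
      ratio (fun i j => w (y i) (y j)) (fun _ => 1) (fun i => w (y m) (y i)) (Finset.univ \ U)) =
    block w {i // i ∈ U} * cluster w {i // i ∉ U} := by
  have h := ((volume_preserving_piEquivPiSubtypeProd (fun _ : ι => Fin d → ℝ)
    (· ∈ U)).lintegral_comp_emb (MeasurableEquiv.measurableEmbedding _) _).trans
    (@lintegral_block_mul_cluster d w hw {i // i ∈ U} {i // i ∉ U} _ (Subtype.fintype (· ∈ U)) _ _)
  refine Eq.trans (lintegral_congr fun y => ?_) (h.trans (by congr!))
  rw [← Finset.sum_coe_sort]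
  refine Finset.sum_congr (by congr!) fun m _ => ?_
  have hU : U.erase m = (Finset.univ.erase m).map
      (OrderEmbedding.subtype (· ∈ U)).toEmbedding := by
    ext i; simp
  have hV : Finset.univ \ U = Finset.univ.map
      (OrderEmbedding.subtype (· ∉ U)).toEmbedding := by
    ext i; simp
  rw [hU, hV, ratio_map, ratio_map, ENNReal.ofReal_mul]
  · unfold blockDensity
    congr!
  · exact hw.blockDensity_nonneg m (fun i => y i)

lemma IsPairWeight.cluster_eq (hw : IsPairWeight w) (n : ℕ) : cluster w (Fin (n + 1)) =
    ∑ k ∈ Finset.range (n + 2),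
      (n + 1).choose k • (block w (Fin k) * cluster w (Fin (n + 1 - k))) := by
  have h : ∀ y : Fin (n + 1) → Fin d → ℝ, ENNReal.ofReal
      (ratio (fun i j => w (y i) (y j)) (fun _ => 1) (fun i => w 0 (y i)) Finset.univ) =
      ∑ U ∈ Finset.univ.powerset, ∑ m ∈ U, ENNReal.ofReal (((1 - w 0 (y m)) *
      ratio (fun i j => w (y i) (y j)) (fun i => w (y m) (y i))
        (fun t => if t < m then w 0 (y t) else 1) (U.erase m)) *
      ratio (fun i j => w (y i) (y j)) (fun _ => 1) (fun i => w (y m) (y i))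
        (Finset.univ \ U)) := by
    intro y
    have hnn : ∀ (U : Finset (Fin (n + 1))) (m : Fin (n + 1)), 0 ≤ ((1 - w 0 (y m)) *
        ratio (fun i j => w (y i) (y j)) (fun i => w (y m) (y i))
          (fun t => if t < m then w 0 (y t) else 1) (U.erase m)) *
        ratio (fun i j => w (y i) (y j)) (fun _ => 1) (fun i => w (y m) (y i))
          (Finset.univ \ U) := fun U m => by
      refine mul_nonneg (mul_nonneg (sub_nonneg.2 (hw.le_one _ _)) (TreeBound.ratio_nonneg
        (fun _ _ => hw.nonneg _ _) (fun _ _ => hw.le_one _ _) (fun _ => hw.nonneg _ _)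
        (fun i => ?_) _)) (hw.ratio_nonneg _ _ _)
      split_ifs
      · exact hw.le_one _ _
      · exact le_rfl
    rw [ratio_renewal (fun _ _ => hw.symm _ _) _ Finset.univ_nonempty.ne_empty,
      ENNReal.ofReal_sum_of_nonneg fun U _ => Finset.sum_nonneg fun m _ => hnn U m]
    exact Finset.sum_congr rfl fun U _ => ENNReal.ofReal_sum_of_nonneg fun m _ => hnn U m
  rw [cluster, lintegral_congr h, lintegral_finsetSum]
  · simp only [hw.lintegral_split]
    have h2 := Finset.sum_powerset_apply_card (x := (Finset.univ : Finset (Fin (n + 1))))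
      (fun k => block w (Fin k) * cluster w (Fin (n + 1 - k)))
    rw [Finset.card_fin] at h2
    rw [← h2]
    refine Finset.sum_congr rfl fun U _ => ?_
    rw [block_congr (U.orderIsoOfFin rfl)]
    congr 1
    refine cluster_congr (κ := Fin (n + 1 - U.card)) (Fintype.orderIsoFinOfCardEq _ ?_)
    rw [Fintype.card_subtype_compl]
    simp
  · intro U _
    refine Finset.measurable_sum _ fun m _ => Measurable.ennreal_ofReal
      (Measurable.mul (Measurable.mul
      (measurable_const.sub (hw.measurable_comp measurable_const (measurable_pi_apply m)))
      (measurable_ratio (fun i j => hw.measurable_comp (measurable_pi_apply i)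
        (measurable_pi_apply j)) (fun i => hw.measurable_comp (measurable_pi_apply m)
        (measurable_pi_apply i)) (fun i => ?_) _)) (measurable_ratio
        (fun i j => hw.measurable_comp (measurable_pi_apply i) (measurable_pi_apply j))
        (fun i => measurable_const) (fun i => hw.measurable_comp (measurable_pi_apply m)
        (measurable_pi_apply i)) _))
    split_ifs
    · exact hw.measurable_comp measurable_const (measurable_pi_apply i)
    · exact measurable_const

end Renewal

section Finiteness

variable {d : ℕ}

lemma lmarginal_parent_prod {n : ℕ} {h : (Fin d → ℝ) → ℝ≥0∞} (hh : Measurable h)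
    {P : Fin n → Fin (n + 1)} {l : Fin (n + 1) → ℕ} (hl : ∀ i, l (P i) < l i.succ)
    (T : Finset (Fin n)) (y : Fin n → Fin d → ℝ) :
    (∫⋯∫⁻_T, (fun y => ∏ i ∈ T, h (y i - (Fin.cons 0 y : Fin (n + 1) → Fin d → ℝ) (P i)))
      ∂fun _ => volume) y = (∫⁻ v, h v) ^ T.card := by
  have hm : ∀ (T : Finset (Fin n)), Measurable fun y : Fin n → Fin d → ℝ =>
      ∏ i ∈ T, h (y i - (Fin.cons 0 y : Fin (n + 1) → Fin d → ℝ) (P i)) := by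
    intro T
    refine Finset.measurable_prod _ fun i _ => hh.comp ((measurable_pi_apply i).sub ?_)
    refine Fin.cases ?_ (fun j => ?_) (P i)
    · simp only [Fin.cons_zero]; exact measurable_const
    · simp only [Fin.cons_succ]; exact measurable_pi_apply j
  induction hn : T.card using Nat.strong_induction_on generalizing T y with
  | _ k ih =>
    subst hn
    rcases T.eq_empty_or_nonempty with rfl | hT
    · simp
    obtain ⟨m, hmT, hmax⟩ := T.exists_max_image (fun i => l i.succ) hT
    have hP : ∀ i ∈ T, P i ≠ m.succ := fun i hi h => by
      have := hl i
      rw [h] at this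
      exact absurd (hmax i hi) (not_le.2 this)
    rw [lmarginal_erase' _ (hm T) hmT]
    have hinner : (fun y : Fin n → Fin d → ℝ => ∫⁻ v, ∏ i ∈ T, h (Function.update y m v i -
        (Fin.cons 0 (Function.update y m v) : Fin (n + 1) → Fin d → ℝ) (P i))) =
        fun y => (∫⁻ v, h v) * ∏ i ∈ T.erase m, h (y i -
          (Fin.cons 0 y : Fin (n + 1) → Fin d → ℝ) (P i)) := by
      funext y
      have : ∀ v, ∏ i ∈ T, h (Function.update y m v i -
          (Fin.cons 0 (Function.update y m v) : Fin (n + 1) → Fin d → ℝ) (P i)) =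
          h (v - (Fin.cons 0 y : Fin (n + 1) → Fin d → ℝ) (P m)) * ∏ i ∈ T.erase m, h (y i -
          (Fin.cons 0 y : Fin (n + 1) → Fin d → ℝ) (P i)) := by
        intro v
        rw [← Finset.mul_prod_erase _ _ hmT, Fin.cons_update]
        congr 1
        · rw [Function.update_self, Function.update_of_ne (hP m hmT)]
        · refine Finset.prod_congr rfl fun i hi => ?_
          rw [Function.update_of_ne (Finset.ne_of_mem_erase hi),
            Function.update_of_ne (hP i (Finset.mem_of_mem_erase hi))]
      simp only [this]
      rw [lintegral_mul_const _ (by fun_prop),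
        lintegral_sub_right_eq_self (fun v => h v)]
    rw [hinner]
    have := ih _ (Finset.card_erase_lt_of_mem hmT) (T.erase m) y rfl
    rw [lmarginal] at this ⊢
    rw [lintegral_const_mul, this, ← pow_succ', Finset.card_erase_add_one hmT]
    exact (hm _).comp measurable_updateFinset

lemma lintegral_parent_prod {n : ℕ} {h : (Fin d → ℝ) → ℝ≥0∞} (hh : Measurable h)
    {P : Fin n → Fin (n + 1)} {l : Fin (n + 1) → ℕ} (hl : ∀ i, l (P i) < l i.succ) :
    ∫⁻ y : Fin n → Fin d → ℝ, ∏ i, h (y i - (Fin.cons 0 y : Fin (n + 1) → Fin d → ℝ) (P i)) =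
      (∫⁻ v, h v) ^ n := by
  have := lmarginal_parent_prod hh hl Finset.univ 0
  rw [lmarginal_univ, Finset.card_fin] at this
  exact this

lemma exists_parent {n : ℕ} {τ : SimpleGraph (Fin (n + 1))} (hτ : τ.Connected) (j : Fin n) :
    ∃ i, j.succ ∈ childrenF τ i := by
  obtain ⟨w, hw⟩ := hτ.exists_walk_length_eq_dist j.succ 0
  cases w with
  | cons h w' =>
    rename_i i
    refine ⟨i, ?_⟩
    simp only [childrenF, Finset.mem_filter, Finset.mem_univ, true_and]
    refine ⟨h.symm, ?_⟩
    have h1 := SimpleGraph.dist_le w'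
    rw [SimpleGraph.Walk.length_cons] at hw
    have h2 := SimpleGraph.dist_le (SimpleGraph.Walk.cons h
      (hτ.exists_walk_length_eq_dist i 0).choose)
    rw [SimpleGraph.Walk.length_cons, (hτ.exists_walk_length_eq_dist i 0).choose_spec] at h2
    rw [SimpleGraph.dist_comm, SimpleGraph.dist_comm (u := 0)]
    omega

lemma IsPairWeight.lintegral_tree_le {w : (Fin d → ℝ) → (Fin d → ℝ) → ℝ} (hw : IsPairWeight w)
    {n : ℕ} {τ : SimpleGraph (Fin (n + 1))} (hτ : τ.Connected) :
    ∫⁻ y : Fin n → Fin d → ℝ, ENNReal.ofReal (∏ i : Fin (n + 1),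
      phiFinset w ((Fin.cons 0 y : Fin (n + 1) → Fin d → ℝ) i) (childrenF τ i) (Fin.cons 0 y)) ≤
      (∫⁻ v, ENNReal.ofReal (1 - w v 0)) ^ n := by
  choose P hP using exists_parent hτ
  have hl : ∀ i, τ.dist 0 (P i) < τ.dist 0 i.succ := fun i => by
    have := (Finset.mem_filter.1 (hP i)).2.2
    omega
  have hmeas : Measurable fun v => ENNReal.ofReal (1 - w v 0) :=
    (measurable_const.sub (hw.measurable_comp measurable_id measurable_const)).ennreal_ofReal
  rw [← lintegral_parent_prod hmeas hl]
  refine lintegral_mono fun y => ?_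
  set x : Fin (n + 1) → Fin d → ℝ := Fin.cons 0 y with hx
  have hone : ∀ x y, 0 ≤ 1 - w x y ∧ 1 - w x y ≤ 1 := fun x y =>
    ⟨sub_nonneg.2 (hw.le_one x y), by linarith [hw.nonneg x y]⟩
  have h1 : ∏ i, phiFinset w (x i) (childrenF τ i) x ≤
      ∏ i, ∏ j ∈ childrenF τ i, (1 - w (x i) (x j)) := by
    refine Finset.prod_le_prod (fun i _ => mul_nonneg (Finset.prod_nonneg fun j _ => (hone _ _).1)
      (Finset.prod_nonneg fun _ _ => hw.nonneg _ _)) fun i _ => ?_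
    exact mul_le_of_le_one_right (Finset.prod_nonneg fun j _ => (hone _ _).1)
      (Finset.prod_le_one (fun _ _ => hw.nonneg _ _) fun _ _ => hw.le_one _ _)
  have h2 : ∏ i, ∏ j ∈ childrenF τ i, (1 - w (x i) (x j)) ≤
      ∏ i : Fin n, (1 - w (x (P i)) (x i.succ)) := by
    rw [Finset.prod_sigma', ← Finset.prod_image (s := Finset.univ)
      (g := fun i : Fin n => (⟨P i, i.succ⟩ : Σ _ : Fin (n + 1), Fin (n + 1)))
      (f := fun q => 1 - w (x q.1) (x q.2))]
    · refine prod_le_prod_of_subset_of_le_one (fun q => (hone _ _).1) (fun q => (hone _ _).2) ?_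
      intro q hq
      obtain ⟨i, -, rfl⟩ := Finset.mem_image.1 hq
      simpa using hP i
    · intro i _ j _ hij
      simp only [Sigma.mk.injEq] at hij
      simpa using hij.2
  refine (ENNReal.ofReal_le_ofReal (h1.trans h2)).trans_eq ?_
  rw [ENNReal.ofReal_prod_of_nonneg fun i _ => (hone _ _).1]
  refine Finset.prod_congr rfl fun i _ => ?_
  have := hw.add_right (x i.succ - x (P i)) 0 (x (P i))
  rw [sub_add_cancel, zero_add] at this
  rw [hw.symm, this, hx, Fin.cons_succ]

lemma IsPairWeight.phiFinset_nonneg {w : (Fin d → ℝ) → (Fin d → ℝ) → ℝ} (hw : IsPairWeight w)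
    {n : ℕ} (x : Fin d → ℝ) (t : Finset (Fin n)) (y : Fin n → Fin d → ℝ) :
    0 ≤ phiFinset w x t y :=
  mul_nonneg (Finset.prod_nonneg fun _ _ => sub_nonneg.2 (hw.le_one _ _))
    (Finset.prod_nonneg fun _ _ => hw.nonneg _ _)

lemma card_trees_le (n : ℕ) :
    ((Finset.univ.filter fun τ : SimpleGraph (Fin (n + 1)) => τ.IsTree).card : ℝ) ≤
      ((n + 1 : ℝ) ^ 2) ^ n / n.factorial := by
  have h1 : (Finset.univ.filter fun τ : SimpleGraph (Fin (n + 1)) => τ.IsTree).card ≤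
      (Finset.powersetCard n (Finset.univ : Finset (Sym2 (Fin (n + 1))))).card := by
    refine Finset.card_le_card_of_injOn (fun τ => τ.edgeFinset) ?_ ?_
    · intro τ hτ
      have := (Finset.mem_filter.1 hτ).2.card_edgeFinset
      simp only [Fintype.card_fin, Nat.add_right_cancel_iff] at this
      simpa using this
    · intro τ _ σ _ h
      exact SimpleGraph.edgeFinset_inj.1 h
  rw [Finset.card_powersetCard, Finset.card_univ] at h1
  have h2 : Fintype.card (Sym2 (Fin (n + 1))) ≤ (n + 1) ^ 2 := by
    rw [sq]
    refine (Fintype.card_le_of_surjective (fun p : Fin (n + 1) × Fin (n + 1) => s(p.1, p.2))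
      fun e => ?_).trans_eq (by rw [Fintype.card_prod, Fintype.card_fin])
    induction e using Sym2.ind with
    | _ u v => exact ⟨(u, v), rfl⟩
  refine (Nat.cast_le.2 (h1.trans (Nat.choose_le_choose n h2))).trans ?_
  refine (Nat.choose_le_pow_div _ _).trans_eq ?_
  push_cast
  rfl

lemma IsPairWeight.lintegral_treeB_le {w : (Fin d → ℝ) → (Fin d → ℝ) → ℝ} (hw : IsPairWeight w)
    (n : ℕ) : ∫⁻ y : Fin n → Fin d → ℝ, ENNReal.ofReal (treeB w n (Fin.cons 0 y)) ≤
      ENNReal.ofReal (((n + 1 : ℝ) ^ 2) ^ n / n.factorial) *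
        (∫⁻ v, ENNReal.ofReal (1 - w v 0)) ^ n := by
  have h : ∀ y : Fin n → Fin d → ℝ, ENNReal.ofReal (treeB w n (Fin.cons 0 y)) =
      ∑ τ : SimpleGraph (Fin (n + 1)) with τ.IsTree, ENNReal.ofReal (∏ i : Fin (n + 1),
      phiFinset w ((Fin.cons 0 y : Fin (n + 1) → Fin d → ℝ) i) (childrenF τ i) (Fin.cons 0 y)) := by
    intro y
    rw [treeB, ← Finset.sum_filter, ENNReal.ofReal_sum_of_nonneg]
    exact fun τ _ => Finset.prod_nonneg fun i _ => hw.phiFinset_nonneg _ _ _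
  have hcons : ∀ i, Measurable fun y : Fin n → Fin d → ℝ =>
      (Fin.cons 0 y : Fin (n + 1) → Fin d → ℝ) i := by
    intro i
    refine Fin.cases ?_ (fun j => ?_) i
    · simp only [Fin.cons_zero]; exact measurable_const
    · simp only [Fin.cons_succ]; exact measurable_pi_apply j
  rw [lintegral_congr h, lintegral_finsetSum]
  · refine (Finset.sum_le_card_nsmul _ _ _ fun τ hτ =>
      hw.lintegral_tree_le (Finset.mem_filter.1 hτ).2.connected).trans ?_
    rw [nsmul_eq_mul]
    refine mul_le_mul_left ?_ _
    rw [← ENNReal.ofReal_natCast]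
    exact ENNReal.ofReal_le_ofReal (card_trees_le n)
  · intro τ _
    refine (Finset.measurable_prod _ fun i _ => Measurable.mul (Finset.measurable_prod _
      fun j _ => measurable_const.sub (hw.measurable_comp (hcons i) (hcons j)))
      (Finset.measurable_prod _ fun p _ => hw.measurable_comp (hcons _) (hcons _))).ennreal_ofReal

end Finiteness

section Coefficients

variable {d : ℕ}

lemma isPairWeight_pairW {β : ℝ} (hβ : 0 < β) {φ : (Fin d → ℝ) → ℝ≥0∞} (hφm : Measurable φ)
    (hφeven : ∀ v, φ (-v) = φ v) : IsPairWeight (pairW β φ) where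
  measurable := by
    have h : Measurable fun p : (Fin d → ℝ) × (Fin d → ℝ) => φ (p.1 - p.2) :=
      hφm.comp (measurable_fst.sub measurable_snd)
    exact Measurable.ite (h (measurableSet_singleton ∞)) measurable_const
      ((h.ennreal_toReal.const_mul β).neg.exp)
  nonneg x y := by
    rw [pairW]
    split_ifs
    · exact le_rfl
    · exact (Real.exp_pos _).le
  le_one x y := by
    rw [pairW]
    split_ifs
    · exact zero_le_one
    · exact Real.exp_le_one_iff.2 (neg_nonpos.2 (mul_nonneg hβ.le ENNReal.toReal_nonneg))
  symm x y := by rw [pairW, pairW, ← hφeven, neg_sub]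
  add_right x y z := by rw [pairW, pairW, add_sub_add_right_eq_sub]

variable {w : (Fin d → ℝ) → (Fin d → ℝ) → ℝ}

/-- The integrated tree weight on `n + 1` vertices. -/
def treeMass (w : (Fin d → ℝ) → (Fin d → ℝ) → ℝ) (n : ℕ) : ℝ≥0∞ :=
  ∫⁻ y : Fin n → Fin d → ℝ, ENNReal.ofReal (treeB w n (Fin.cons 0 y))

lemma IsPairWeight.cluster_le_treeMass (hw : IsPairWeight w) (n : ℕ) :
    cluster w (Fin n) ≤ treeMass w n :=
  lintegral_mono fun y => ENNReal.ofReal_le_ofReal (ratio_le_treeB hw.nonneg hw.le_one 0 y)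

lemma cluster_zero : cluster w (Fin 0) = 1 := by
  rw [cluster]
  simp [Finset.univ_eq_empty, volume_pi]

lemma block_zero : block w (Fin 0) = 0 := by simp [block]

lemma IsPairWeight.block_le_cluster (hw : IsPairWeight w) (n : ℕ) :
    block w (Fin n) ≤ cluster w (Fin n) := by
  cases n with
  | zero => simp [block_zero]
  | succ n =>
    rw [hw.cluster_eq n]
    refine le_trans ?_ (Finset.single_le_sum (fun _ _ => zero_le)
      (Finset.mem_range.2 (Nat.lt_succ_self (n + 1))))
    rw [Nat.choose_self, one_smul, Nat.sub_self, cluster_zero, mul_one]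

lemma pow_mul_card_trees_le (m : ℕ) {r c : ℝ} (hr : 0 ≤ r) (hc : 0 ≤ c) :
    r ^ m / m.factorial * (((m + 1 : ℝ) ^ 2) ^ m / m.factorial * c ^ m) ≤
      Real.exp 2 * (r * c * Real.exp 2) ^ m := by
  have h := Real.pow_div_factorial_le_exp (m + 1 : ℝ) (by positivity) m
  have h2 : ((m + 1 : ℝ) ^ m / m.factorial) ^ 2 ≤ Real.exp (m + 1 : ℝ) ^ 2 :=
    pow_le_pow_left₀ (by positivity) h 2
  have h3 : Real.exp (m + 1 : ℝ) ^ 2 = Real.exp 2 * Real.exp 2 ^ m := by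
    rw [← Real.exp_nat_mul, ← Real.exp_nat_mul, ← Real.exp_add]
    congr 1
    push_cast
    ring
  calc r ^ m / m.factorial * (((m + 1 : ℝ) ^ 2) ^ m / m.factorial * c ^ m)
      = (r * c) ^ m * ((m + 1 : ℝ) ^ m / m.factorial) ^ 2 := by
        rw [mul_pow, div_pow, ← pow_mul, ← pow_mul, mul_comm 2 m]; ring
    _ ≤ (r * c) ^ m * (Real.exp 2 * Real.exp 2 ^ m) := by
        rw [← h3]
        exact mul_le_mul_of_nonneg_left h2 (by positivity)
    _ = _ := by rw [mul_pow (r * c)]; ring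

lemma IsPairWeight.exists_tsum_treeMass_lt_top (hw : IsPairWeight w)
    (hT : ∫⁻ v, ENNReal.ofReal (1 - w v 0) < ∞) :
    ∃ r : ℝ, 0 < r ∧ ∑' n : ℕ, ENNReal.ofReal (r ^ n / n.factorial) * treeMass w n < ∞ := by
  set c := (∫⁻ v, ENNReal.ofReal (1 - w v 0)).toReal with hc
  have hc0 : 0 ≤ c := ENNReal.toReal_nonneg
  have he : 0 < Real.exp 2 := Real.exp_pos 2
  refine ⟨1 / (2 * Real.exp 2 * (c + 1)), by positivity, ?_⟩
  set r := 1 / (2 * Real.exp 2 * (c + 1)) with hr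
  have hr0 : 0 < r := by positivity
  have hle : r * c * Real.exp 2 ≤ 1 / 2 := by
    have : r * c * Real.exp 2 = c / (c + 1) * (1 / 2) := by
      rw [hr]; field_simp
    rw [this]
    refine mul_le_of_le_one_left (by norm_num) ?_
    rw [div_le_one (by positivity)]
    linarith
  have hterm : ∀ n : ℕ, ENNReal.ofReal (r ^ n / n.factorial) * treeMass w n ≤
      ENNReal.ofReal (Real.exp 2 * (1 / 2 : ℝ) ^ n) := by
    intro n
    refine (mul_le_mul_right (hw.lintegral_treeB_le n) _).trans ?_
    rw [← ENNReal.ofReal_toReal hT.ne, ← hc, ← ENNReal.ofReal_pow hc0,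
      ← ENNReal.ofReal_mul (by positivity), ← ENNReal.ofReal_mul (by positivity)]
    refine ENNReal.ofReal_le_ofReal ((pow_mul_card_trees_le n hr0.le hc0).trans ?_)
    gcongr
  refine (ENNReal.tsum_le_tsum hterm).trans_lt ?_
  rw [← ENNReal.ofReal_tsum_of_nonneg (fun n => by positivity)
    ((summable_geometric_of_lt_one (by norm_num) (by norm_num)).mul_left _)]
  exact ENNReal.ofReal_lt_top

lemma treeMass_zero : treeMass w 0 = 1 := by
  have h : ∀ y : Fin 1 → Fin d → ℝ, treeB w 0 y = 1 := by
    intro y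
    have : Subsingleton (Fin (0 + 1)) := inferInstanceAs (Subsingleton (Fin 1))
    have : ∀ τ : SimpleGraph (Fin 1), τ.IsTree := fun τ => SimpleGraph.IsTree.of_subsingleton
    have hc : ∀ (τ : SimpleGraph (Fin 1)) i, childrenF τ i = ∅ := by
      intro τ i
      refine Finset.filter_eq_empty_iff.2 fun j _ h => ?_
      exact h.1.ne (Subsingleton.elim _ _)
    simp [treeB, this, hc, phiFinset]
  rw [treeMass, lintegral_congr fun y => by rw [h]]
  simp [volume_pi]

lemma treeSum_eq_tsum (β : ℝ) (φ : (Fin d → ℝ) → ℝ≥0∞) (r : ℝ) :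
    treeSum β φ r = ∑' n : ℕ, ENNReal.ofReal (r ^ n / n.factorial) * treeMass (pairW β φ) n := by
  rw [tsum_eq_zero_add' ENNReal.summable, treeMass_zero]
  simp [treeSum, treeMass]

lemma treeSum_mono (β : ℝ) (φ : (Fin d → ℝ) → ℝ≥0∞) {r s : ℝ} (hr : 0 ≤ r) (hrs : r ≤ s) :
    treeSum β φ r ≤ treeSum β φ s := by
  rw [treeSum, treeSum]
  gcongr

lemma one_le_treeSum (β : ℝ) (φ : (Fin d → ℝ) → ℝ≥0∞) (r : ℝ) : 1 ≤ treeSum β φ r :=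
  le_self_add

/-- The Taylor coefficients of the generating function of the absolute cluster integrals. -/
def clusterCoef (w : (Fin d → ℝ) → (Fin d → ℝ) → ℝ) (n : ℕ) : ℝ :=
  (cluster w (Fin n)).toReal / n.factorial

/-- The Taylor coefficients of the generating function of the block integrals. -/
def blockCoef (w : (Fin d → ℝ) → (Fin d → ℝ) → ℝ) (n : ℕ) : ℝ :=
  (block w (Fin n)).toReal / n.factorial

lemma clusterCoef_zero : clusterCoef w 0 = 1 := by simp [clusterCoef, cluster_zero]

lemma blockCoef_zero : blockCoef w 0 = 0 := by simp [blockCoef, block_zero]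

lemma clusterCoef_nonneg (n : ℕ) : 0 ≤ clusterCoef w n := by
  rw [clusterCoef]; positivity

lemma blockCoef_nonneg (n : ℕ) : 0 ≤ blockCoef w n := by
  rw [blockCoef]; positivity

lemma IsPairWeight.cluster_ne_top (hw : IsPairWeight w)
    (hT : ∫⁻ v, ENNReal.ofReal (1 - w v 0) < ∞) (n : ℕ) : cluster w (Fin n) ≠ ∞ := by
  refine ((hw.cluster_le_treeMass n).trans (hw.lintegral_treeB_le n)).trans_lt ?_ |>.ne
  exact ENNReal.mul_lt_top ENNReal.ofReal_lt_top (ENNReal.pow_lt_top hT)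

lemma IsPairWeight.clusterCoef_succ (hw : IsPairWeight w)
    (hT : ∫⁻ v, ENNReal.ofReal (1 - w v 0) < ∞) (n : ℕ) :
    clusterCoef w (n + 1) =
      ∑ k ∈ Finset.range (n + 2), blockCoef w k * clusterCoef w (n + 1 - k) := by
  have hb : ∀ k, block w (Fin k) ≠ ∞ := fun k =>
    ne_top_of_le_ne_top (hw.cluster_ne_top hT k) (hw.block_le_cluster k)
  rw [clusterCoef, hw.cluster_eq, ENNReal.toReal_sum, Finset.sum_div]
  · refine Finset.sum_congr rfl fun k hk => ?_
    have hk' : k ≤ n + 1 := Nat.lt_succ_iff.1 (Finset.mem_range.1 hk)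
    rw [nsmul_eq_mul, ENNReal.toReal_mul, ENNReal.toReal_mul, ENNReal.toReal_natCast,
      Nat.cast_choose ℝ hk', blockCoef, clusterCoef]
    field_simp
  · intro k _
    rw [nsmul_eq_mul]
    exact ENNReal.mul_ne_top (ENNReal.natCast_ne_top _)
      (ENNReal.mul_ne_top (hb k) (hw.cluster_ne_top hT _))

lemma IsPairWeight.blockCoef_le_clusterCoef (hw : IsPairWeight w)
    (hT : ∫⁻ v, ENNReal.ofReal (1 - w v 0) < ∞) (n : ℕ) : blockCoef w n ≤ clusterCoef w n :=
  div_le_div_of_nonneg_right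
    (ENNReal.toReal_mono (hw.cluster_ne_top hT n) (hw.block_le_cluster n)) (by positivity)

lemma bCoef_eq {β : ℝ} {φ : (Fin d → ℝ) → ℝ≥0∞} (hw : IsPairWeight (pairW β φ)) (n : ℕ) :
    bCoef β φ n = (-1) ^ n * (cluster (pairW β φ) (Fin n)).toReal := by
  simp only [bCoef, omegaT_cons hw.symm]
  rw [integral_const_mul, cluster, integral_eq_lintegral_of_nonneg_ae]
  · exact ae_of_all _ fun y => hw.ratio_nonneg 0 y Finset.univ
  · exact (measurable_ratio
      (fun i j => hw.measurable_comp (measurable_pi_apply i) (measurable_pi_apply j))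
      (fun _ => measurable_const)
      (fun i => hw.measurable_comp measurable_const (measurable_pi_apply i))
      _).aestronglyMeasurable

lemma IsPairWeight.summable_clusterCoef {β : ℝ} {φ : (Fin d → ℝ) → ℝ≥0∞}
    (hw : IsPairWeight (pairW β φ)) (hT : ∫⁻ v, ENNReal.ofReal (1 - pairW β φ v 0) < ∞)
    {r : ℝ} (hr : 0 ≤ r) (hB : treeSum β φ r < ∞) :
    Summable (fun n => clusterCoef (pairW β φ) n * r ^ n) ∧
      ∑' n, clusterCoef (pairW β φ) n * r ^ n ≤ (treeSum β φ r).toReal := by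
  set f : ℕ → ℝ≥0∞ := fun n =>
    ENNReal.ofReal (r ^ n / n.factorial) * cluster (pairW β φ) (Fin n) with hf
  have hle : ∑' n, f n ≤ treeSum β φ r := by
    rw [treeSum_eq_tsum]
    exact ENNReal.tsum_le_tsum fun n => mul_le_mul_right (hw.cluster_le_treeMass n) _
  have hterm : (fun n => clusterCoef (pairW β φ) n * r ^ n) = fun n => (f n).toReal := by
    funext n
    rw [hf, ENNReal.toReal_mul, ENNReal.toReal_ofReal (by positivity), clusterCoef]
    ring
  rw [hterm]
  refine ⟨ENNReal.summable_toReal (hle.trans_lt hB).ne, ?_⟩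
  rw [← ENNReal.tsum_toReal_eq fun n =>
    ENNReal.mul_ne_top ENNReal.ofReal_ne_top (hw.cluster_ne_top hT n)]
  exact ENNReal.toReal_mono hB.ne hle

end Coefficients

section PowerSeriesInversion

open PowerSeries

lemma coeff_pow_eq_sum_piAntidiag (g : ℝ⟦X⟧) (k N m : ℕ) (hm : m < N) :
    coeff m (g ^ k) = ∑ α ∈ Finset.piAntidiag (Finset.univ : Finset (Fin N)) k with
        ∑ i : Fin N, i.1 * α i = m,
      (Nat.multinomial Finset.univ α : ℝ) * ∏ i : Fin N, coeff i.1 g ^ α i := by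
  have h1 : coeff m (g ^ k) = ((trunc N g) ^ k).coeff m := by
    rw [← coeff_coe_trunc_of_lt hm, ← trunc_trunc_pow, coeff_coe_trunc_of_lt hm,
      ← Polynomial.coe_pow, Polynomial.coeff_coe]
  have h2 : trunc N g = ∑ i : Fin N, Polynomial.C (coeff i.1 g) * Polynomial.X ^ i.1 := by
    rw [trunc_apply, ← Finset.range_eq_Ico, Finset.sum_range]
    simp only [Polynomial.C_mul_X_pow_eq_monomial]
  rw [h1, h2, Finset.sum_pow_eq_sum_piAntidiag, Polynomial.finsetSum_coeff, Finset.sum_filter]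
  refine Finset.sum_congr rfl fun α _ => ?_
  have h3 : ∏ i : Fin N, (Polynomial.C (coeff i.1 g) * Polynomial.X ^ i.1) ^ α i =
      Polynomial.C (∏ i : Fin N, coeff i.1 g ^ α i) *
        Polynomial.X ^ (∑ i : Fin N, i.1 * α i) := by
    simp only [mul_pow, Finset.prod_mul_distrib, ← pow_mul, Finset.prod_pow_eq_pow_sum, map_prod,
      map_pow]
  rw [h3, ← Polynomial.C_eq_natCast, ← mul_assoc, ← Polynomial.C_mul, Polynomial.coeff_C_mul_X_pow]
  simp only [eq_comm (a := m)]

lemma factorial_mul_bellPoly {n k : ℕ} (hkn : k ≤ n) (y : ℕ → ℝ) :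
    (k.factorial : ℝ) * BellPoly n k y / n.factorial =
      coeff n ((X * mk fun i => y (i + 1) / (i + 1).factorial : ℝ⟦X⟧) ^ k) := by
  have hdeg : ∀ α : Fin (n - k + 1) → ℕ, ∑ i, α i = k →
      ((∑ i : Fin (n - k + 1), (i.1 + 1) * α i) = n ↔ ∑ i, i.1 * α i = n - k) := by
    intro α hα
    simp only [add_mul, one_mul, Finset.sum_add_distrib, hα]
    omega
  rw [mul_pow, coeff_X_pow_mul', if_pos hkn,
    coeff_pow_eq_sum_piAntidiag _ k (n - k + 1) (n - k) (Nat.lt_succ_self _), BellPoly,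
    mul_div_assoc, Finset.sum_div, Finset.mul_sum]
  have hset : ((Fintype.piFinset fun _ : Fin (n - k + 1) => Finset.range (n + 1)) |>.filter
      (fun α : Fin (n - k + 1) → ℕ =>
        (∑ i, α i) = k ∧ (∑ i : Fin (n - k + 1), (i.1 + 1) * α i) = n)) =
      {α ∈ Finset.piAntidiag (Finset.univ : Finset (Fin (n - k + 1))) k |
        ∑ i : Fin (n - k + 1), i.1 * α i = n - k} := by
    ext α
    simp only [Finset.mem_filter, Fintype.mem_piFinset, Finset.mem_range, Finset.mem_piAntidiag,
      Finset.mem_univ, implies_true, and_true]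
    refine ⟨fun h => ⟨h.2.1, (hdeg α h.2.1).1 h.2.2⟩,
      fun h => ⟨fun i => ?_, h.1, (hdeg α h.1).2 h.2⟩⟩
    have hi := Finset.single_le_sum (fun j _ => Nat.zero_le (α j)) (Finset.mem_univ i)
    exact Nat.lt_succ_of_le (hi.trans (h.1.le.trans hkn))
  rw [hset]
  refine Finset.sum_congr rfl fun α hα => ?_
  have hα' : ∑ i, α i = k := (Finset.mem_piAntidiag.1 (Finset.mem_filter.1 hα).1).1
  have hspec : (∏ i, ((α i).factorial : ℝ)) * (Nat.multinomial Finset.univ α : ℝ) =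
      k.factorial := by
    have h := Nat.multinomial_spec Finset.univ α
    rw [hα'] at h
    exact_mod_cast h
  have hne : ∏ i, ((α i).factorial : ℝ) ≠ 0 :=
    Finset.prod_ne_zero_iff.2 fun i _ => Nat.cast_ne_zero.2 (Nat.factorial_ne_zero _)
  simp only [coeff_mk]
  rw [← hspec]
  field_simp

lemma genBinom_neg (d k : ℕ) :
    genBinom (-((d + 1 : ℕ) : ℝ)) k = (-1) ^ k * ((d + k).choose d : ℝ) := by
  have h : ∏ i ∈ Finset.range k, (-((d + 1 : ℕ) : ℝ) - i) =
      (-1) ^ k * ((d + 1).ascFactorial k : ℝ) := by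
    rw [Nat.ascFactorial_eq_prod_range, ← Finset.card_range k, ← Finset.prod_const,
      Finset.card_range, Nat.cast_prod, ← Finset.prod_mul_distrib]
    refine Finset.prod_congr rfl fun i _ => ?_
    push_cast
    ring
  have hchoose : (d + 1 + k - 1).choose k = (d + k).choose d := by
    rw [show d + 1 + k - 1 = d + k by omega, Nat.choose_symm_add]
  rw [genBinom, h, Nat.ascFactorial_eq_factorial_mul_choose', hchoose]
  push_cast
  field_simp

lemma sum_genBinom_mul_coeff_pow {n : ℕ} (hn : 1 ≤ n) {f u : ℝ⟦X⟧} (hf : constantCoeff f = 0)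
    (hu : u * (1 + f) = 1) :
    ∑ k ∈ Finset.Icc 1 n, genBinom (-(n : ℝ)) k * coeff n (f ^ k) = coeff n (u ^ n) := by
  obtain ⟨d, rfl⟩ : ∃ d, n = d + 1 := ⟨n - 1, by omega⟩
  have hs : HasSubst (-f) := HasSubst.of_constantCoeff_zero' (by simp [hf])
  have h1 := congrArg (substAlgHom (R := ℝ) hs) (mk_add_choose_mul_one_sub_pow_eq_one ℝ d)
  rw [map_mul, map_pow, map_sub, map_one, substAlgHom_X, sub_neg_eq_add, coe_substAlgHom] at h1
  have h2 : u ^ (d + 1) = subst (-f) (mk fun n ↦ Nat.choose (d + n) d : ℝ⟦X⟧) := by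
    calc u ^ (d + 1) = u ^ (d + 1) *
          (subst (-f) (mk fun n ↦ Nat.choose (d + n) d : ℝ⟦X⟧) * (1 + f) ^ (d + 1)) := by
          rw [h1, mul_one]
      _ = subst (-f) (mk fun n ↦ Nat.choose (d + n) d : ℝ⟦X⟧) * (u * (1 + f)) ^ (d + 1) := by
          rw [mul_pow]; ring
      _ = _ := by rw [hu, one_pow, mul_one]
  rw [h2, coeff_subst' hs, finsum_eq_sum_of_support_subset (s := Finset.Icc 1 (d + 1))]
  · refine Finset.sum_congr rfl fun k _ => ?_
    rw [genBinom_neg, coeff_mk, neg_pow f, smul_eq_mul,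
      show ((-1 : ℝ⟦X⟧) ^ k) = C ((-1 : ℝ) ^ k) by simp, coeff_C_mul]
    ring
  · intro k hk
    rw [Function.mem_support, coeff_mk] at hk
    rw [Finset.coe_Icc, Set.mem_Icc]
    by_contra hcon
    apply hk
    rcases Nat.eq_zero_or_pos k with rfl | hk0
    · simp [coeff_one]
    · have hdvd : (X : ℝ⟦X⟧) ^ k ∣ (-f) ^ k :=
        pow_dvd_pow_of_dvd (X_dvd_iff.2 (by simp [hf])) k
      rw [X_pow_dvd_iff.1 hdvd (d + 1) (by omega), smul_zero]

lemma abs_coeff_pow_le {p q : ℝ⟦X⟧} (h : ∀ n, |coeff n p| ≤ coeff n q) (m n : ℕ) :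
    |coeff n (p ^ m)| ≤ coeff n (q ^ m) := by
  induction m generalizing n with
  | zero =>
    rw [pow_zero, pow_zero, coeff_one]
    split_ifs <;> simp
  | succ m ih =>
    rw [pow_succ, pow_succ, coeff_mul, coeff_mul]
    refine (Finset.abs_sum_le_sum_abs _ _).trans (Finset.sum_le_sum fun x _ => ?_)
    rw [abs_mul]
    exact mul_le_mul (ih _) (h _) (abs_nonneg _) ((abs_nonneg _).trans (ih _))

lemma summable_coeff_mul {p q : ℝ⟦X⟧} {r : ℝ}
    (hps : Summable fun n => coeff n p * r ^ n) (hqs : Summable fun n => coeff n q * r ^ n) :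
    (Summable fun n => coeff n (p * q) * r ^ n) ∧
      ∑' n, coeff n (p * q) * r ^ n = (∑' n, coeff n p * r ^ n) * ∑' n, coeff n q * r ^ n := by
  have h : ∀ n, coeff n (p * q) * r ^ n =
      ∑ x ∈ Finset.HasAntidiagonal.antidiagonal n,
        (coeff x.1 p * r ^ x.1) * (coeff x.2 q * r ^ x.2) := by
    intro n
    rw [coeff_mul, Finset.sum_mul]
    refine Finset.sum_congr rfl fun x hx => ?_
    rw [← Finset.HasAntidiagonal.mem_antidiagonal.1 hx, pow_add]
    ring
  have hpn : Summable fun n => ‖coeff n p * r ^ n‖ := hps.norm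
  have hqn : Summable fun n => ‖coeff n q * r ^ n‖ := hqs.norm
  simp only [h]
  exact ⟨(summable_norm_sum_mul_antidiagonal_of_summable_norm hpn hqn).of_norm,
    (tsum_mul_tsum_eq_tsum_sum_antidiagonal_of_summable_norm hpn hqn).symm⟩

lemma summable_coeff_pow {p : ℝ⟦X⟧} {r : ℝ} (hp : ∀ n, 0 ≤ coeff n p)
    (hps : Summable fun n => coeff n p * r ^ n) (m : ℕ) :
    (∀ n, 0 ≤ coeff n (p ^ m)) ∧ (Summable fun n => coeff n (p ^ m) * r ^ n) ∧
      ∑' n, coeff n (p ^ m) * r ^ n = (∑' n, coeff n p * r ^ n) ^ m := by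
  have hnn : ∀ m n, 0 ≤ coeff n (p ^ m) := fun m n =>
    (abs_nonneg _).trans (abs_coeff_pow_le (fun n => (abs_of_nonneg (hp n)).le) m n)
  refine ⟨hnn m, ?_⟩
  induction m with
  | zero =>
    have h : ∀ n, n ≠ 0 → coeff n ((p : ℝ⟦X⟧) ^ 0) * r ^ n = 0 := by
      intro n hn
      rw [pow_zero, coeff_one, if_neg hn, zero_mul]
    refine ⟨summable_of_ne_finset_zero (s := {0}) fun n hn => h n (by simpa using hn), ?_⟩
    rw [tsum_eq_single 0 h]
    simp
  | succ m ih =>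
    obtain ⟨h1, h2⟩ := summable_coeff_mul ih.1 hps
    rw [pow_succ, pow_succ]
    exact ⟨h1, by rw [h2, ih.2]⟩

/-- If `A = 1 + c A` with nonnegative coefficients, then the coefficients of `(1 - c) ^ m` are
bounded by means of the value `2 - 1 / A(r)` of `1 + c` at `r`. -/
lemma abs_coeff_one_sub_pow_le {A c : ℝ⟦X⟧} {r B : ℝ} (hr : 0 ≤ r) (hA : ∀ n, 0 ≤ coeff n A)
    (hc : ∀ n, 0 ≤ coeff n c) (hcA : ∀ n, coeff n c ≤ coeff n A) (h : A = 1 + c * A)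
    (hAs : Summable fun n => coeff n A * r ^ n) (hB : ∑' n, coeff n A * r ^ n ≤ B) (m n : ℕ) :
    |coeff n ((1 - c) ^ m)| * r ^ n ≤ (2 - 1 / B) ^ m := by
  have hterm : ∀ n, 0 ≤ coeff n c * r ^ n := fun n => mul_nonneg (hc n) (pow_nonneg hr n)
  have hcs : Summable fun n => coeff n c * r ^ n :=
    hAs.of_nonneg_of_le hterm fun n => mul_le_mul_of_nonneg_right (hcA n) (pow_nonneg hr n)
  have hone := summable_coeff_pow hA hAs 0
  rw [pow_zero, pow_zero] at hone
  have hmul := summable_coeff_mul hcs hAs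
  have hsum : ∑' n, coeff n A * r ^ n =
      1 + (∑' n, coeff n c * r ^ n) * ∑' n, coeff n A * r ^ n := by
    conv_lhs => rw [h]
    simp only [map_add, add_mul]
    rw [hone.2.1.tsum_add hmul.1, hone.2.2, hmul.2]
  have hplus : ∀ n, coeff n (1 + c) * r ^ n = coeff n (1 : ℝ⟦X⟧) * r ^ n + coeff n c * r ^ n :=
    fun n => by rw [map_add, add_mul]
  have hplusnn : ∀ n, 0 ≤ coeff n (1 + c) := fun n => by
    rw [map_add]; exact add_nonneg (hone.1 n) (hc n)
  have hpluss : Summable fun n => coeff n (1 + c) * r ^ n := by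
    simp only [hplus]
    exact hone.2.1.add hcs
  have hval : ∑' n, coeff n (1 + c) * r ^ n = 1 + ∑' n, coeff n c * r ^ n := by
    simp only [hplus]
    rw [hone.2.1.tsum_add hcs, hone.2.2]
  obtain ⟨hn1, hn2, hn3⟩ := summable_coeff_pow hplusnn hpluss m
  have habs : ∀ n, |coeff n (1 - c)| ≤ coeff n (1 + c) := fun n => by
    rw [map_sub, map_add]
    refine (abs_sub _ _).trans_eq ?_
    rw [abs_of_nonneg (hone.1 n), abs_of_nonneg (hc n)]
  calc |coeff n ((1 - c) ^ m)| * r ^ n ≤ coeff n ((1 + c) ^ m) * r ^ n :=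
        mul_le_mul_of_nonneg_right (abs_coeff_pow_le habs m n) (pow_nonneg hr n)
    _ ≤ (1 + ∑' n, coeff n c * r ^ n) ^ m := by
        rw [← hval, ← hn3]
        exact hn2.le_tsum n fun k _ => mul_nonneg (hn1 k) (pow_nonneg hr k)
    _ ≤ (2 - 1 / B) ^ m := by
        set S := ∑' n, coeff n c * r ^ n
        set T := ∑' n, coeff n A * r ^ n
        have hS : 0 ≤ S := tsum_nonneg hterm
        have hT : 0 ≤ T := tsum_nonneg fun n => mul_nonneg (hA n) (pow_nonneg hr n)
        have hT1 : 1 ≤ T := by nlinarith [mul_nonneg hS hT]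
        have hSe : S = 1 - 1 / T := by
          have : T ≠ 0 := by positivity
          field_simp
          linarith
        have : 1 / B ≤ 1 / T := one_div_le_one_div_of_le (by linarith) hB
        exact pow_le_pow_left₀ (by linarith) (by linarith) m

end PowerSeriesInversion

section VirialBounds

open PowerSeries

variable {d : ℕ} {β : ℝ} {φ : (Fin d → ℝ) → ℝ≥0∞}

lemma IsPairWeight.mk_clusterCoef {w : (Fin d → ℝ) → (Fin d → ℝ) → ℝ} (hw : IsPairWeight w)
    (hT : ∫⁻ v, ENNReal.ofReal (1 - w v 0) < ∞) :
    PowerSeries.mk (clusterCoef w) =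
      1 + PowerSeries.mk (blockCoef w) * PowerSeries.mk (clusterCoef w) := by
  ext n
  rw [map_add, coeff_mk, coeff_mul, Finset.Nat.sum_antidiagonal_eq_sum_range_succ_mk]
  simp only [coeff_mk]
  cases n with
  | zero => simp [clusterCoef_zero, blockCoef_zero]
  | succ n => simp [hw.clusterCoef_succ hT n, coeff_one]

lemma vCoef_div_factorial (hw : IsPairWeight (pairW β φ))
    (hT : ∫⁻ v, ENNReal.ofReal (1 - pairW β φ v 0) < ∞) {n : ℕ} (hn : 1 ≤ n) :
    vCoef β φ n / n.factorial =
      (-1) ^ n * coeff n ((1 - mk (blockCoef (pairW β φ)) : ℝ⟦X⟧) ^ n) := by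
  set A : ℝ⟦X⟧ := mk (clusterCoef (pairW β φ)) with hA
  set c : ℝ⟦X⟧ := mk (blockCoef (pairW β φ)) with hc
  set f : ℝ⟦X⟧ := X * mk fun i => bCoef β φ (i + 1) / (i + 1).factorial with hf
  have hAc : A = 1 + c * A := hw.mk_clusterCoef hT
  have hfA : 1 + f = rescale (-1) A := by
    ext n
    rw [coeff_rescale, hA, coeff_mk, map_add, hf]
    cases n with
    | zero => simp [clusterCoef_zero]
    | succ n => simp [coeff_succ_X_mul, coeff_one, bCoef_eq hw, clusterCoef, mul_div_assoc]
  have hu : rescale (-1) (1 - c) * (1 + f) = 1 := by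
    rw [hfA, ← map_mul, show (1 - c) * A = 1 by linear_combination hAc, map_one]
  rw [vCoef, if_neg (by omega), Finset.sum_div]
  have hterm : ∀ k ∈ Finset.Icc 1 n, genBinom (-(n : ℝ)) k * (k.factorial : ℝ) *
      BellPoly n k (fun j => bCoef β φ j) / n.factorial =
      genBinom (-(n : ℝ)) k * coeff n (f ^ k) := by
    intro k hk
    rw [Finset.mem_Icc] at hk
    rw [hf, ← factorial_mul_bellPoly hk.2 (fun j => bCoef β φ j)]
    ring
  rw [Finset.sum_congr rfl hterm, sum_genBinom_mul_coeff_pow hn (by simp [hf]) hu, ← map_pow,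
    coeff_rescale]

lemma abs_vCoef_mul_pow_le (hw : IsPairWeight (pairW β φ))
    (hT : ∫⁻ v, ENNReal.ofReal (1 - pairW β φ v 0) < ∞) {n : ℕ} (hn : 1 ≤ n) {r : ℝ}
    (hr : 0 ≤ r) (hB : treeSum β φ r < ∞) :
    |vCoef β φ n| / n.factorial * r ^ n ≤ (2 - 1 / (treeSum β φ r).toReal) ^ n := by
  obtain ⟨hs, hle⟩ := hw.summable_clusterCoef hT hr hB
  have h : |vCoef β φ n| / n.factorial =
      |coeff n ((1 - mk (blockCoef (pairW β φ)) : ℝ⟦X⟧) ^ n)| := by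
    rw [← Nat.abs_cast n.factorial, ← abs_div, vCoef_div_factorial hw hT hn, abs_mul,
      abs_pow, abs_neg, abs_one, one_pow, one_mul]
  rw [h]
  refine abs_coeff_one_sub_pow_le (A := mk (clusterCoef (pairW β φ))) hr ?_ ?_ ?_
    (hw.mk_clusterCoef hT) ?_ ?_ n n
  · intro k; rw [coeff_mk]; exact clusterCoef_nonneg k
  · intro k; rw [coeff_mk]; exact blockCoef_nonneg k
  · intro k; rw [coeff_mk, coeff_mk]; exact hw.blockCoef_le_clusterCoef hT k
  · simpa only [coeff_mk] using hs
  · simpa only [coeff_mk] using hle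

/-- The ratio `2 / r - 1 / (r * 𝓑(r))` bounding the growth of the virial coefficients. -/
def virialRate (β : ℝ) (φ : (Fin d → ℝ) → ℝ≥0∞) (r : ℝ) : ℝ :=
  2 / r - 1 / (r * (treeSum β φ r).toReal)

lemma one_le_toReal_treeSum {r : ℝ} (hB : treeSum β φ r < ∞) : 1 ≤ (treeSum β φ r).toReal := by
  have := ENNReal.toReal_mono hB.ne (one_le_treeSum β φ r)
  rwa [ENNReal.toReal_one] at this

lemma virialRate_eq {r : ℝ} (hr : 0 < r) (hB : treeSum β φ r < ∞) :
    virialRate β φ r = (r * (treeSum β φ r).toReal / (2 * (treeSum β φ r).toReal - 1))⁻¹ := by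
  have h := one_le_toReal_treeSum hB
  have : (treeSum β φ r).toReal ≠ 0 := by positivity
  rw [virialRate, inv_div]
  field_simp

lemma virialRate_pos {r : ℝ} (hr : 0 < r) (hB : treeSum β φ r < ∞) : 0 < virialRate β φ r := by
  have h := one_le_toReal_treeSum hB
  rw [virialRate_eq hr hB]
  exact inv_pos.2 (div_pos (by positivity) (by linarith))

lemma abs_vCoef_le (hw : IsPairWeight (pairW β φ))
    (hT : ∫⁻ v, ENNReal.ofReal (1 - pairW β φ v 0) < ∞) {n : ℕ} (hn : 1 ≤ n) {r : ℝ}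
    (hr : 0 < r) (hB : treeSum β φ r < ∞) :
    |vCoef β φ n| / n.factorial ≤ virialRate β φ r ^ n := by
  have h := abs_vCoef_mul_pow_le hw hT hn hr.le hB
  have hrate : virialRate β φ r = (2 - 1 / (treeSum β φ r).toReal) / r := by
    rw [virialRate, sub_div, div_div, mul_comm r]
  rwa [hrate, div_pow, le_div_iff₀ (pow_pos hr n)]

lemma abs_vCoef_div_factorial_succ (n : ℕ) :
    |vCoef β φ n| / ((n + 1).factorial : ℝ) =
      (1 / ((n : ℝ) + 1)) * (|vCoef β φ n| / n.factorial) := by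
  rw [Nat.factorial_succ]
  push_cast
  field_simp

lemma le_sInf_pow {s : Set ℝ} (hs : s.Nonempty) (h0 : ∀ e ∈ s, 0 ≤ e) {x : ℝ} {n : ℕ}
    (hn : n ≠ 0) (hx : 0 ≤ x) (h : ∀ e ∈ s, x ≤ e ^ n) : x ≤ sInf s ^ n := by
  have hroot : x ^ (n : ℝ)⁻¹ ≤ sInf s := by
    refine le_csInf hs fun e he => ?_
    rw [← Real.pow_rpow_inv_natCast (h0 e he) hn]
    exact Real.rpow_le_rpow hx (h e he) (by positivity)
  calc x = (x ^ (n : ℝ)⁻¹) ^ n := (Real.rpow_inv_natCast_pow hx hn).symm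
    _ ≤ sInf s ^ n := pow_le_pow_left₀ (Real.rpow_nonneg hx _) hroot n

end VirialBounds

end TreeBound

open TreeBound

/-- bounds on the virial coefficients and the virial radius of convergence.
Here `0 < r < r**` (with `r**` the radius of convergence of `𝓑`) is expressed as
`0 < r ∧ ∃ r' > r, 𝓑(r') < ∞`, which is equivalent since `𝓑` has nonnegative coefficients. -/
theorem statement14 {d : ℕ} (hd : 1 ≤ d) (β : ℝ) (hβ : 0 < β)
    (φ : (Fin d → ℝ) → ℝ≥0∞) (hφm : Measurable φ) (hφeven : ∀ v, φ (-v) = φ v)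
    (hT : ∫⁻ v : Fin d → ℝ, ENNReal.ofReal (1 - pairW β φ v 0) < ∞) :
    (∀ n : ℕ, 1 ≤ n → ∀ r : ℝ, 0 < r → (∃ r' : ℝ, r < r' ∧ treeSum β φ r' < ∞) →
      |vCoef β φ n| / ((n + 1).factorial : ℝ)
        ≤ (1 / ((n : ℝ) + 1)) *
          (2 / r - 1 / (r * (treeSum β φ r).toReal)) ^ n) ∧
    (∀ n : ℕ, 1 ≤ n →
      |vCoef β φ n| / ((n + 1).factorial : ℝ)
        ≤ (1 / ((n : ℝ) + 1)) *
          (sInf {e : ℝ | ∃ r : ℝ, (0 < r ∧ ∃ r' : ℝ, r < r' ∧ treeSum β φ r' < ∞) ∧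
              e = 2 / r - 1 / (r * (treeSum β φ r).toReal)}) ^ n) ∧
    ∀ z : ℂ, ENNReal.ofReal ‖z‖ <
        (⨆ (r : ℝ) (_ : 0 < r ∧ ∃ r' : ℝ, r < r' ∧ treeSum β φ r' < ∞),
          ENNReal.ofReal (r * (treeSum β φ r).toReal / (2 * (treeSum β φ r).toReal - 1))) →
      Summable (fun n : ℕ => (vCoef β φ n : ℂ) / ((n + 1).factorial : ℂ) * z ^ (n + 1)) := by
  have hw := isPairWeight_pairW hβ hφm hφeven
  have hfin : ∀ {r : ℝ}, (0 < r ∧ ∃ r' : ℝ, r < r' ∧ treeSum β φ r' < ∞) → treeSum β φ r < ∞ := by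
    rintro r ⟨hr, r', hrr', hB⟩
    exact (treeSum_mono β φ hr.le hrr'.le).trans_lt hB
  refine ⟨fun n hn r hr hr' => ?_, fun n hn => ?_, fun z hz => ?_⟩
  · rw [abs_vCoef_div_factorial_succ]
    exact mul_le_mul_of_nonneg_left (abs_vCoef_le hw hT hn hr (hfin ⟨hr, hr'⟩)) (by positivity)
  · rw [abs_vCoef_div_factorial_succ]
    refine mul_le_mul_of_nonneg_left (le_sInf_pow ?_ ?_ (by omega) (by positivity) ?_)
      (by positivity)
    · obtain ⟨r, hr, hB⟩ := hw.exists_tsum_treeMass_lt_top hT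
      rw [← treeSum_eq_tsum] at hB
      exact ⟨_, r / 2, ⟨half_pos hr, r, half_lt_self hr, hB⟩, rfl⟩
    · rintro e ⟨r, hr, rfl⟩
      exact (virialRate_pos hr.1 (hfin hr)).le
    · rintro e ⟨r, hr, rfl⟩
      exact abs_vCoef_le hw hT hn hr.1 (hfin hr)
  · obtain ⟨r, hz⟩ := lt_iSup_iff.1 hz
    obtain ⟨hr, hz⟩ := lt_iSup_iff.1 hz
    have hpos := virialRate_pos hr.1 (hfin hr)
    have hz1 : virialRate β φ r * ‖z‖ < 1 := by
      have h := (ENNReal.ofReal_lt_ofReal_iff_of_nonneg (norm_nonneg z)).1 hz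
      rw [← inv_inv (r * _ / _), ← virialRate_eq hr.1 (hfin hr)] at h
      rwa [← one_div, lt_div_iff₀' hpos] at h
    refine Summable.of_norm_bounded (g := fun n => ‖z‖ * (virialRate β φ r * ‖z‖) ^ n)
      ((summable_geometric_of_lt_one (by positivity) hz1).mul_left _) fun n => ?_
    have hle : |vCoef β φ n| / ((n + 1).factorial : ℝ) ≤ virialRate β φ r ^ n := by
      rcases Nat.eq_zero_or_pos n with rfl | hn
      · simp [vCoef]
      · rw [abs_vCoef_div_factorial_succ]
        refine (mul_le_of_le_one_left (by positivity) ?_).trans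
          (abs_vCoef_le hw hT hn hr.1 (hfin hr))
        rw [div_le_one (by positivity)]
        linarith [Nat.cast_nonneg (α := ℝ) n]
    rw [norm_mul, norm_div, norm_pow, Complex.norm_real, Complex.norm_natCast, Real.norm_eq_abs,
      pow_succ, mul_pow]
    calc |vCoef β φ n| / ((n + 1).factorial : ℝ) * (‖z‖ ^ n * ‖z‖)
        ≤ virialRate β φ r ^ n * (‖z‖ ^ n * ‖z‖) := mul_le_mul_of_nonneg_right hle (by positivity)
      _ = _ := by ring
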